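/- arXiv:2512.13535 — 5 statements merged into one kernel-verified Lean document; each statement's English description precedes it below -/
import Mathlib

section
/- Let d ≥ 1, let f : ℝ → ℝ be continuously differentiable, let b : ℝ^d → ℝ be continuously differentiable, and let a ∈ ℝ. Then for Lebesgue-almost every y ∈ ℝ^d, the function G : ℝ^d → ℝ defined by G(y) = sign(a − b(y))·(f(a) − f(b(y))) is differentiable at y with gradient ∇G(y) = −sign(a − b(y))·f′(b(y))·∇b(y). -/
open MeasureTheory Real
open scoped RealInnerProductSpace

noncomputable section

/-- `d`-dimensional Euclidean space. -/
abbrev Euc (d : ℕ) := EuclideanSpace ℝ (Fin d)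

/-- Divergence of a vector field on `ℝ^d`. -/
def diverg {d : ℕ} (V : Euc d → Euc d) (x : Euc d) : ℝ :=
  ∑ i, ⟪fderiv ℝ V x (EuclideanSpace.single i 1), EuclideanSpace.single i (1:ℝ)⟫

/-- Laplacian of a scalar function on `ℝ^d`. -/
def lap {d : ℕ} (u : Euc d → ℝ) (x : Euc d) : ℝ :=
  ∑ i, fderiv ℝ (fun y => fderiv ℝ u y (EuclideanSpace.single i 1)) x
    (EuclideanSpace.single i 1)

/-- The derivative of a differentiable function vanishes almost everywhere on each level set. -/
theorem ae_fderiv_eq_zero_of_eq {E : Type*} [NormedAddCommGroup E] [NormedSpace ℝ E]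
    [FiniteDimensional ℝ E] [Nontrivial E] [MeasurableSpace E] [BorelSpace E]
    (μ : Measure E) [μ.IsAddHaarMeasure] {b : E → ℝ} (hb : Differentiable ℝ b) (a : ℝ) :
    ∀ᵐ y ∂μ, b y = a → fderiv ℝ b y = 0 := by
  obtain ⟨v, hv⟩ := exists_ne (0 : E)
  have hs : MeasurableSet {y | b y = a} := (isClosed_eq hb.continuous continuous_const).measurableSet
  have happ : ApproximatesLinearOn (fun y => b y • v) (0 : E →L[ℝ] E) {y | b y = a} 0 := by
    intro x hx y hy
    simp only [Set.mem_ofPred_eq] at hx hy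
    simp [hx, hy]
  have h := happ.norm_fderiv_sub_le μ hs (fun y => (fderiv ℝ b y).smulRight v)
    fun y _ => ((hb y).hasFDerivAt.smul_const v).hasFDerivWithinAt
  rw [ae_restrict_iff' hs] at h
  filter_upwards [h] with y hy hya
  have h0 := hy hya
  rw [sub_zero, nonpos_iff_eq_zero, nnnorm_eq_zero] at h0
  ext w
  simpa [hv] using DFunLike.congr_fun h0 w

/-- The sign function is locally constant away from zero. -/
theorem eventually_sign_eq {x : ℝ} (hx : x ≠ 0) : ∀ᶠ t in nhds x, Real.sign t = Real.sign x := by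
  rcases hx.lt_or_gt with h | h
  · filter_upwards [eventually_lt_nhds h] with t ht
    rw [Real.sign_of_neg ht, Real.sign_of_neg h]
  · filter_upwards [eventually_gt_nhds h] with t ht
    rw [Real.sign_of_pos ht, Real.sign_of_pos h]

theorem stmt_3 (d : ℕ) (hd : 1 ≤ d) (f : ℝ → ℝ) (hf : ContDiff ℝ 1 f)
    (b : Euc d → ℝ) (hb : ContDiff ℝ 1 b) (a : ℝ) :
    ∀ᵐ y ∂(volume : Measure (Euc d)),
      HasGradientAt (fun z => Real.sign (a - b z) * (f a - f (b z)))
        ((-(Real.sign (a - b y) * deriv f (b y))) • gradient b y) y := by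
  have : Nonempty (Fin d) := ⟨⟨0, hd⟩⟩
  have hbd : Differentiable ℝ b := hb.differentiable one_ne_zero
  have hfd : Differentiable ℝ f := hf.differentiable one_ne_zero
  filter_upwards [ae_fderiv_eq_zero_of_eq volume hbd a] with y hy
  rw [hasGradientAt_iff_hasFDerivAt]
  have hcomp : HasFDerivAt (fun z => f a - f (b z)) (-(deriv f (b y) • fderiv ℝ b y)) y :=
    ((hfd (b y)).hasDerivAt.comp_hasFDerivAt y (hbd y).hasFDerivAt).const_sub (f a)
  have hgrad : InnerProductSpace.toDual ℝ (Euc d)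
      ((-(Real.sign (a - b y) * deriv f (b y))) • gradient b y)
      = Real.sign (a - b y) • (-(deriv f (b y) • fderiv ℝ b y)) := by
    simp [gradient, mul_smul]
  rw [hgrad]
  by_cases hya : b y = a
  · rw [hy hya, smul_zero, neg_zero] at hcomp ⊢
    rw [smul_zero, hasFDerivAt_iff_isLittleO_nhds_zero]
    rw [hasFDerivAt_iff_isLittleO_nhds_zero] at hcomp
    simp only [hya, sub_self, sub_zero, mul_zero, _root_.zero_apply] at hcomp ⊢
    refine Asymptotics.IsBigO.trans_isLittleO (.of_bound 1 (.of_forall fun z => ?_)) hcomp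
    rw [norm_mul]
    gcongr
    rcases Real.sign_apply_eq (a - b (y + z)) with h | h | h <;> simp [h]
  · refine (hcomp.const_smul (Real.sign (a - b y))).congr_of_eventuallyEq ?_
    have hcont : ContinuousAt (fun z => a - b z) y :=
      (continuous_const.sub hbd.continuous).continuousAt
    filter_upwards [hcont.eventually (eventually_sign_eq (sub_ne_zero.mpr (Ne.symm hya)))] with z hz
    simp [hz]
end
end

section
/- Let d ≥ 1 and M_V, M_a, M_b > 0. Let V : ℝ^d → ℝ^d be measurable with ‖V(x)‖ ≤ M_V for almost every x; let a : ℝ^d → ℝ be measurable with |a(x)| ≤ M_a for almost every x; let b : ℝ^d → ℝ be continuously differentiable with |b(y)| ≤ M_b for all y and ∫‖∇b‖ < ∞; let f : ℝ → ℝ be continuously differentiable; and let ψ, φ : ℝ^d → ℝ be continuously differentiable with compact support. Then ∫∫_{ℝ^d×ℝ^d} [∇ψ(x+y)·V(x)·φ(x−y) − ψ(x+y)·∇φ(x−y)·V(x)] · sign(a(x) − b(y))·(f(a(x)) − f(b(y))) dx dy ≤ (sup|ψ|)·(∫|φ|)·(∫‖∇b‖)·M_V·sup_{|ξ| ≤ M_b}|f′(ξ)|.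 (The bracket equals the divergence in y of the field y ↦ ψ(x+y)φ(x−y)V(x).) -/
open MeasureTheory Real
open scoped RealInnerProductSpace

noncomputable section

open Filter Topology Set

/-- For a `C¹` function `f`, the map `β ↦ sign (α - β) * (f α - f β)` is Lipschitz on any interval
where the derivative of `f` is bounded by `L`. -/
lemma abs_sign_mul_sub_sub_le {f : ℝ → ℝ} {L : ℝ} {s : Set ℝ} (hs : s.OrdConnected)
    (hf : Differentiable ℝ f) (hL : ∀ ξ ∈ s, |deriv f ξ| ≤ L) (α : ℝ) {β γ : ℝ}
    (hβ : β ∈ s) (hγ : γ ∈ s) :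
    |Real.sign (α - β) * (f α - f β) - Real.sign (α - γ) * (f α - f γ)| ≤ L * |β - γ| := by
  have key : ∀ x ∈ s, ∀ y ∈ s, |f x - f y| ≤ L * |x - y| := fun x hx y hy =>
    Convex.norm_image_sub_le_of_norm_deriv_le (fun z _ => hf z) hL hs.convex hy hx
  have mul_sign : ∀ x, Real.sign (α - x) * (f α - f x) =
      if x ≤ α then f α - f x else f x - f α := by
    intro x
    split_ifs with h
    · rcases h.eq_or_lt with rfl | h
      · simp
      · rw [Real.sign_of_pos (by linarith), one_mul]
    · rw [Real.sign_of_neg (by linarith)]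
      ring
  rw [mul_sign, mul_sign]
  have hsymm := key β hβ γ hγ
  split_ifs with h₁ h₂ h₂
  · rw [abs_sub_comm (f α - f β), sub_sub_sub_cancel_left]
    exact hsymm
  · push Not at h₂
    have hα : α ∈ s := hs.out hβ hγ ⟨h₁, h₂.le⟩
    have k₁ := key α hα β hβ
    have k₂ := key α hα γ hγ
    rw [abs_of_nonneg (by linarith : 0 ≤ α - β)] at k₁
    rw [abs_of_nonpos (by linarith : α - γ ≤ 0)] at k₂
    rw [abs_of_nonpos (by linarith : β - γ ≤ 0)]
    calc _ = |(f α - f β) + (f α - f γ)| := by congr 1; ring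
      _ ≤ _ := abs_add_le _ _
      _ ≤ _ := by linarith
  · push Not at h₁
    have hα : α ∈ s := hs.out hγ hβ ⟨h₂, h₁.le⟩
    have k₁ := key α hα β hβ
    have k₂ := key α hα γ hγ
    rw [abs_of_nonpos (by linarith : α - β ≤ 0)] at k₁
    rw [abs_of_nonneg (by linarith : 0 ≤ α - γ)] at k₂
    rw [abs_of_nonneg (by linarith : 0 ≤ β - γ)]
    calc _ = |(f α - f β) + (f α - f γ)| := by rw [← abs_neg]; congr 1; ring
      _ ≤ _ := abs_add_le _ _
      _ ≤ _ := by linarith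
  · rw [sub_sub_sub_cancel_right]
    exact hsymm

section DifferenceQuotients

variable {E : Type*} [NormedAddCommGroup E] [NormedSpace ℝ E] [FiniteDimensional ℝ E]
  [MeasurableSpace E] [BorelSpace E] {μ : Measure E} [μ.IsAddHaarMeasure]

/-- Difference quotients of a `C¹` function converge in `L¹` against a continuous compactly
supported weight. -/
lemma tendsto_integral_abs_mul_abs_slope {Φ b : E → ℝ} (hΦ : Continuous Φ)
    (hΦc : HasCompactSupport Φ) (hb : ContDiff ℝ 1 b) (v : E) :
    Tendsto (fun t : ℝ => ∫ y, |Φ y| * |t⁻¹ • (b (y + t • v) - b y)| ∂μ) (𝓝[>] 0)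
      (𝓝 (∫ y, |Φ y| * |fderiv ℝ b y v| ∂μ)) := by
  obtain ⟨R, hR⟩ := hΦc.isCompact.isBounded.subset_closedBall (0 : E)
  obtain ⟨K, hK⟩ := hb.contDiffOn.exists_lipschitzOnWith one_ne_zero
    (convex_closedBall (0 : E) (R + ‖v‖)) (isCompact_closedBall _ _)
  refine tendsto_integral_filter_of_dominated_convergence (fun y => |Φ y| * (K * ‖v‖)) ?_ ?_ ?_ ?_
  · refine .of_forall fun t => Continuous.aestronglyMeasurable ?_
    have := hb.continuous
    fun_prop
  · filter_upwards [Ioc_mem_nhdsGT (zero_lt_one' ℝ)] with t ht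
    refine .of_forall fun y => ?_
    rw [norm_mul, norm_eq_abs, norm_eq_abs, abs_abs, abs_abs]
    by_cases hy : y ∈ tsupport Φ
    · gcongr
      have hy' : ‖y‖ ≤ R := by simpa using hR hy
      have htv : ‖t • v‖ ≤ ‖v‖ := by
        rw [norm_smul, norm_eq_abs, abs_of_pos ht.1]
        exact mul_le_of_le_one_left (norm_nonneg _) ht.2
      have h := hK.dist_le_mul (y + t • v)
        (by simpa using (norm_add_le _ _).trans (add_le_add hy' htv)) y
        (by simpa using hy'.trans (le_add_of_nonneg_right (norm_nonneg v)))
      rw [Real.dist_eq, dist_eq_norm, add_sub_cancel_left, norm_smul, norm_eq_abs,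
        abs_of_pos ht.1] at h
      rw [smul_eq_mul, abs_mul, abs_inv, abs_of_pos ht.1, inv_mul_le_iff₀ ht.1]
      linarith
    · simp [image_eq_zero_of_notMem_tsupport hy]
  · exact (hΦ.integrable_of_hasCompactSupport hΦc).abs.mul_const _
  · refine .of_forall fun y => ?_
    have h := ((hb.differentiable one_ne_zero y).hasFDerivAt.hasLineDerivAt
      v).tendsto_slope_zero_right
    exact h.abs.const_mul _

/-- Weak form of the chain rule estimate `|D_v g| ≤ L |D_v b|`, where `g` is a function whose
increments are controlled by those of the `C¹` function `b`. -/
lemma abs_integral_fderiv_mul_le {Φ b g : E → ℝ} (hΦ : ContDiff ℝ 1 Φ)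
    (hΦc : HasCompactSupport Φ) (hb : ContDiff ℝ 1 b) {L : ℝ}
    (hg : ∀ y z, |g y - g z| ≤ L * |b y - b z|) (v : E) :
    |∫ y, fderiv ℝ Φ y v * g y ∂μ| ≤ L * ∫ y, |Φ y| * |fderiv ℝ b y v| ∂μ := by
  have hgc : Continuous g := by
    refine continuous_iff_continuousAt.2 fun y => tendsto_iff_dist_tendsto_zero.2 ?_
    have h : Tendsto (fun z => L * |b z - b y|) (𝓝 y) (𝓝 0) := by
      have hc : Continuous fun z => L * |b z - b y| := by
        have := hb.continuous
        fun_prop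
      simpa using hc.tendsto y
    exact squeeze_zero (fun _ => dist_nonneg) (fun z => hg z y) h
  obtain ⟨C, hC⟩ := hΦ.lipschitzWith_of_hasCompactSupport hΦc one_ne_zero
  have lim := hC.integral_inv_smul_sub_mul_tendsto_integral_lineDeriv_mul' (μ := μ) hΦc hgc v
  simp_rw [fun y => ((hΦ.differentiable one_ne_zero y).lineDeriv_eq_fderiv (v := v))] at lim
  have lim' := (tendsto_integral_abs_mul_abs_slope (μ := μ) hΦ.continuous hΦc hb (-v)).const_mul L
  simp only [map_neg, abs_neg] at lim'
  refine le_of_tendsto_of_tendsto lim.abs lim' ?_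
  filter_upwards [self_mem_nhdsWithin] with t ht
  have hΦcont := hΦ.continuous
  have hbcont := hb.continuous
  have int₁ : Integrable (fun y => Φ y * g (y + t • -v)) μ :=
    Continuous.integrable_of_hasCompactSupport (by fun_prop) hΦc.mul_right
  have int₂ : Integrable (fun y => Φ y * g y) μ :=
    Continuous.integrable_of_hasCompactSupport (by fun_prop) hΦc.mul_right
  have int₃ : Integrable (fun y => Φ (y + t • v) * g y) μ := by
    simpa [add_assoc] using int₁.comp_add_right (t • v)
  have hshift : ∫ y, Φ (y + t • v) * g y ∂μ = ∫ y, Φ y * g (y + t • -v) ∂μ := by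
    simpa [add_assoc] using integral_add_right_eq_self (μ := μ)
      (fun y => Φ y * g (y + t • -v)) (t • v)
  have hparts : ∫ y, t⁻¹ • (Φ (y + t • v) - Φ y) * g y ∂μ
      = ∫ y, Φ y * (t⁻¹ • (g (y + t • -v) - g y)) ∂μ := by
    calc _ = ∫ y, t⁻¹ * (Φ (y + t • v) * g y - Φ y * g y) ∂μ := by
          congr 1 with y; rw [smul_eq_mul]; ring
      _ = ∫ y, t⁻¹ * (Φ y * g (y + t • -v) - Φ y * g y) ∂μ := by
          rw [integral_const_mul, integral_const_mul, integral_sub int₃ int₂,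
            integral_sub int₁ int₂, hshift]
      _ = _ := by
          congr 1 with y; rw [smul_eq_mul]; ring
  rw [hparts, ← integral_const_mul]
  refine norm_integral_le_of_norm_le (f := fun y => Φ y * (t⁻¹ • (g (y + t • -v) - g y))) ?_
    (.of_forall fun y => ?_)
  · exact (Continuous.integrable_of_hasCompactSupport (by fun_prop)
      (hΦc.comp_left abs_zero).mul_right).const_mul _
  · rw [norm_eq_abs, abs_mul, smul_eq_mul, smul_eq_mul, abs_mul, abs_mul]
    have h := mul_le_mul_of_nonneg_left (hg (y + t • -v) y)
      (mul_nonneg (abs_nonneg (Φ y)) (abs_nonneg t⁻¹))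
    linarith

end DifferenceQuotients

theorem stmt_4 (d : ℕ) (hd : 1 ≤ d) (MV Ma Mb : ℝ)
    (hMV : 0 < MV) (hMa : 0 < Ma) (hMb : 0 < Mb)
    (V : Euc d → Euc d) (hVmeas : Measurable V)
    (hVb : ∀ᵐ x ∂(volume : Measure (Euc d)), ‖V x‖ ≤ MV)
    (a : Euc d → ℝ) (hameas : Measurable a)
    (hab : ∀ᵐ x ∂(volume : Measure (Euc d)), |a x| ≤ Ma)
    (b : Euc d → ℝ) (hb : ContDiff ℝ 1 b) (hbb : ∀ y, |b y| ≤ Mb)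
    (hbgrad : Integrable (fun y => gradient b y))
    (f : ℝ → ℝ) (hf : ContDiff ℝ 1 f)
    (ψ φ : Euc d → ℝ) (hψ : ContDiff ℝ 1 ψ) (hψc : HasCompactSupport ψ)
    (hφ : ContDiff ℝ 1 φ) (hφc : HasCompactSupport φ) :
    (∫ x, ∫ y,
        (⟪gradient ψ (x + y), V x⟫ * φ (x - y) - ψ (x + y) * ⟪gradient φ (x - y), V x⟫)
          * (Real.sign (a x - b y) * (f (a x) - f (b y))))
      ≤ (⨆ z, |ψ z|) * (∫ z, |φ z|) * (∫ y, ‖gradient b y‖) * MV *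
          sSup ((fun ξ => |deriv f ξ|) '' Set.Icc (-Mb) Mb) := by
  set L := sSup ((fun ξ => |deriv f ξ|) '' Set.Icc (-Mb) Mb)
  set S := ⨆ z, |ψ z|
  have hL : ∀ ξ ∈ Set.Icc (-Mb) Mb, |deriv f ξ| ≤ L := fun ξ hξ =>
    le_csSup (isCompact_Icc.image ((hf.continuous_deriv le_rfl).abs)).bddAbove ⟨ξ, hξ, rfl⟩
  have hL0 : 0 ≤ L := (abs_nonneg _).trans (hL 0 ⟨by linarith, hMb.le⟩)
  have hS : ∀ z, |ψ z| ≤ S := by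
    obtain ⟨C, hC⟩ := hψc.exists_bound_of_continuous hψ.continuous
    exact fun z => le_ciSup (f := fun z => |ψ z|) ⟨C, by rintro _ ⟨z, rfl⟩; exact hC z⟩ z
  have hS0 : 0 ≤ S := (abs_nonneg _).trans (hS 0)
  have hφint : Integrable (fun z => |φ z|) :=
    (hφ.continuous.integrable_of_hasCompactSupport hφc).abs
  let conv : Euc d → ℝ := fun x => ∫ y, ‖gradient b y‖ * |φ (x - y)|
  have hconv : Integrable conv :=
    hbgrad.norm.integrable_convolution (ContinuousLinearMap.mul ℝ ℝ) hφint
  have hconv_eq : ∫ x, conv x = (∫ y, ‖gradient b y‖) * ∫ z, |φ z| :=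
    integral_convolution (ContinuousLinearMap.mul ℝ ℝ) hbgrad.norm hφint
  have hbound : ∀ᵐ x ∂(volume : Measure (Euc d)),
      ‖∫ y, (⟪gradient ψ (x + y), V x⟫ * φ (x - y) - ψ (x + y) * ⟪gradient φ (x - y), V x⟫)
        * (Real.sign (a x - b y) * (f (a x) - f (b y)))‖ ≤ L * (S * MV) * conv x := by
    filter_upwards [hVb] with x hx
    have hΦ : ContDiff ℝ 1 fun y => ψ (x + y) * φ (x - y) := by fun_prop
    have hΦc : HasCompactSupport fun y => ψ (x + y) * φ (x - y) :=
      (hψc.comp_homeomorph (Homeomorph.addLeft x)).mul_right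
    have hderiv : ∀ y, fderiv ℝ (fun y => ψ (x + y) * φ (x - y)) y (V x) =
        ⟪gradient ψ (x + y), V x⟫ * φ (x - y) - ψ (x + y) * ⟪gradient φ (x - y), V x⟫ := by
      intro y
      have h₁ : HasFDerivAt (fun y => ψ (x + y)) (fderiv ℝ ψ (x + y)) y :=
        (hasFDerivAt_comp_add_left x).2 (hψ.differentiable one_ne_zero _).hasFDerivAt
      have h₂ : HasFDerivAt (fun y => φ (x - y)) (-fderiv ℝ φ (x - y)) y := by
        simpa using! (hφ.differentiable one_ne_zero (x - y)).hasFDerivAt.comp y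
          ((hasFDerivAt_id y).const_sub x)
      have h₁₂ : HasFDerivAt (fun y => ψ (x + y) * φ (x - y)) _ y := h₁.mul h₂
      rw [h₁₂.fderiv, inner_gradient_left, inner_gradient_left]
      simp
      ring
    have hle := abs_integral_fderiv_mul_le (μ := volume) hΦ hΦc hb
      (g := fun y => Real.sign (a x - b y) * (f (a x) - f (b y)))
      (fun y z => abs_sign_mul_sub_sub_le Set.ordConnected_Icc (hf.differentiable one_ne_zero) hL
        (a x) (abs_le.1 (hbb y)) (abs_le.1 (hbb z))) (V x)
    simp_rw [hderiv] at hle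
    rw [mul_assoc]
    refine hle.trans (mul_le_mul_of_nonneg_left ?_ hL0)
    rw [← integral_const_mul]
    refine integral_mono_of_nonneg (.of_forall fun y => by positivity) ?_ (.of_forall fun y => ?_)
    · obtain ⟨C, hC⟩ := hφc.exists_bound_of_continuous hφ.continuous
      have hφcont := hφ.continuous
      refine (hbgrad.norm.mul_bdd (c := C) ?_ (.of_forall fun y => ?_)).const_mul _
      · exact Continuous.aestronglyMeasurable (by fun_prop)
      · simpa using hC (x - y)
    · have hgrad : |fderiv ℝ b y (V x)| ≤ ‖gradient b y‖ * MV := by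
        rw [← inner_gradient_left]
        exact (abs_real_inner_le_norm _ _).trans (by gcongr)
      calc |ψ (x + y) * φ (x - y)| * |fderiv ℝ b y (V x)|
          ≤ (S * |φ (x - y)|) * (‖gradient b y‖ * MV) := by
            rw [abs_mul]
            gcongr
            exact hS _
        _ = _ := by ring
  refine (le_abs_self _).trans ((norm_integral_le_of_norm_le (hconv.const_mul _) hbound).trans ?_)
  rw [integral_const_mul, hconv_eq]
  exact le_of_eq (by ring)
end
end

section
/- Let d ≥ 1 and L, M_a, M_b > 0. Let V : ℝ^d → ℝ^d be continuously differentiable with ‖DV(y)‖ ≤ L (operator norm of the Jacobian) for all y, so that V is L-Lipschitz; let a : ℝ^d → ℝ be measurable with |a(x)| ≤ M_a for almost every x; let b : ℝ^d → ℝ be continuously differentiable with |b(y)| ≤ M_b for all y and ∫‖∇b‖ < ∞; let f : ℝ → ℝ be continuously differentiable; and let ψ, φ : ℝ^d → ℝ be continuously differentiable with compact support. Then ∫∫_{ℝ^d×ℝ^d} [∇ψ(x+y)·(V(x)−V(y))·φ(x−y) − ψ(x+y)·∇φ(x−y)·(V(x)−V(y)) − ψ(x+y)·φ(x−y)·div V(y)]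 · sign(a(x) − b(y))·(f(a(x)) − f(b(y))) dx dy ≤ (sup|ψ|)·(sup_{|ξ| ≤ M_b}|f′(ξ)|)·(∫‖∇b‖)·L·M₁(φ), where M₁(φ) := ∫_{ℝ^d}‖z‖·|φ(z)|dz. (The bracket equals the divergence in y of the field y ↦ ψ(x+y)φ(x−y)(V(x)−V(y)).) -/
open MeasureTheory Real
open scoped RealInnerProductSpace

noncomputable section

open Filter Topology

lemma apply_eq_sum_single {d : ℕ} (A : Euc d →L[ℝ] ℝ) (v : Euc d) :
    A v = ∑ i, v i * A (EuclideanSpace.single i 1) := by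
  conv_lhs => rw [← (EuclideanSpace.basisFun (Fin d) ℝ).sum_repr v]
  simp

/-- Integration by parts for the divergence of a compactly supported `C¹` field. -/
lemma integral_diverg_mul {d : ℕ} {X : Euc d → Euc d} {u : Euc d → ℝ}
    (hX : ContDiff ℝ 1 X) (hXc : HasCompactSupport X) (hu : ContDiff ℝ 1 u) :
    ∫ y, diverg X y * u y = -∫ y, fderiv ℝ u y (X y) := by
  set e : Fin d → Euc d := fun i => EuclideanSpace.single i 1 with he
  have hXi (i) : ContDiff ℝ 1 (fun y => X y i) := by fun_prop
  have hXic (i) : HasCompactSupport (fun y => X y i) :=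
    hXc.comp_left (g := fun v : Euc d => v i) rfl
  have hXi' (i) : Continuous (fun y => fderiv ℝ (fun z => X z i) y (e i)) :=
    ((hXi i).continuous_fderiv one_ne_zero).clm_apply continuous_const
  have hu' (i) : Continuous (fun y => fderiv ℝ u y (e i)) :=
    (hu.continuous_fderiv one_ne_zero).clm_apply continuous_const
  have hXic' (i) : HasCompactSupport (fun y => fderiv ℝ (fun z => X z i) y (e i)) :=
    (hXic i).fderiv_apply ℝ (e i)
  have hint₁ (i) : Integrable (fun y => fderiv ℝ (fun z => X z i) y (e i) * u y) :=
    ((hXi' i).mul hu.continuous).integrable_of_hasCompactSupport (hXic' i).mul_right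
  have hint₂ (i) : Integrable (fun y => X y i * fderiv ℝ u y (e i)) :=
    ((hXi i).continuous.mul (hu' i)).integrable_of_hasCompactSupport (hXic i).mul_right
  have hint₃ (i) : Integrable (fun y => X y i * u y) :=
    ((hXi i).continuous.mul hu.continuous).integrable_of_hasCompactSupport (hXic i).mul_right
  have hleft (y) : diverg X y * u y = ∑ i, fderiv ℝ (fun z => X z i) y (e i) * u y := by
    have hcoord (i) : fderiv ℝ (fun z => X z i) y (e i) = fderiv ℝ X y (e i) i := by
      have h := ((EuclideanSpace.proj (𝕜 := ℝ) i).hasFDerivAt.comp y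
        (hX.differentiable one_ne_zero y).hasFDerivAt).fderiv
      exact DFunLike.congr_fun h (e i)
    simp only [hcoord, ← Finset.sum_mul]
    simp [diverg, he, EuclideanSpace.inner_single_right]
  have hright (y) : fderiv ℝ u y (X y) = ∑ i, X y i * fderiv ℝ u y (e i) :=
    apply_eq_sum_single _ _
  simp only [hleft, hright]
  rw [integral_finsetSum _ fun i _ => hint₁ i, integral_finsetSum _ fun i _ => hint₂ i,
    ← Finset.sum_neg_distrib]
  refine Finset.sum_congr rfl fun i _ => ?_
  rw [integral_mul_fderiv_eq_neg_fderiv_mul_of_integrable (hint₁ i) (hint₂ i) (hint₃ i)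
    (fun x _ => (hXi i).differentiable one_ne_zero x)
    (fun x _ => hu.differentiable one_ne_zero x), neg_neg]

lemma diverg_smul {d : ℕ} {w : Euc d → ℝ} {U : Euc d → Euc d} {y : Euc d}
    (hw : DifferentiableAt ℝ w y) (hU : DifferentiableAt ℝ U y) :
    diverg (fun z => w z • U z) y = fderiv ℝ w y (U y) + w y * diverg U y := by
  rw [apply_eq_sum_single, diverg, diverg, fderiv_fun_smul hw hU, Finset.mul_sum, ← Finset.sum_add_distrib]
  refine Finset.sum_congr rfl fun i _ => ?_
  simp [EuclideanSpace.inner_single_right]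
  ring

/-- The divergence in `y` of `ψ (x + y) φ (x - y) (V x - V y)`. -/
lemma diverg_doubling {d : ℕ} {V : Euc d → Euc d} {ψ φ : Euc d → ℝ}
    (hV : Differentiable ℝ V) (hψ : Differentiable ℝ ψ) (hφ : Differentiable ℝ φ)
    (x y : Euc d) :
    diverg (fun z => (ψ (x + z) * φ (x - z)) • (V x - V z)) y =
      ⟪gradient ψ (x + y), V x - V y⟫ * φ (x - y)
        - ψ (x + y) * ⟪gradient φ (x - y), V x - V y⟫
        - ψ (x + y) * φ (x - y) * diverg V y := by
  have hψx : HasFDerivAt (fun z => ψ (x + z)) (fderiv ℝ ψ (x + y)) y :=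
    ((hψ (x + y)).hasFDerivAt.comp y ((hasFDerivAt_id y).const_add x)).congr_fderiv
      (ContinuousLinearMap.comp_id _)
  have hφx : HasFDerivAt (fun z => φ (x - z)) (-fderiv ℝ φ (x - y)) y :=
    ((hφ (x - y)).hasFDerivAt.comp y ((hasFDerivAt_id y).const_sub x)).congr_fderiv
      (by ext v; simp)
  have hdiv : diverg (fun z => V x - V z) y = -diverg V y := by
    simp [diverg, fderiv_const_sub]
  have hw : HasFDerivAt (fun z => ψ (x + z) * φ (x - z)) _ y := hψx.mul hφx
  rw [diverg_smul hw.differentiableAt ((hV y).const_sub _), hdiv, hw.fderiv]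
  simp [gradient]
  ring

/-- `ξ ↦ sign (α - ξ) * (f α - f ξ)` is a pointwise limit of `C¹` functions whose derivatives are
dominated by that of `f`. -/
lemma exists_contDiff_tendsto_sign_mul_sub {f : ℝ → ℝ} (hf : ContDiff ℝ 1 f) (α : ℝ) :
    ∃ (g : ℕ → ℝ → ℝ) (B : ℝ → ℝ), (∀ n, ContDiff ℝ 1 (g n)) ∧ Continuous B ∧
      (∀ n ξ, |deriv (g n) ξ| ≤ |deriv f ξ|) ∧ (∀ n ξ, |g n ξ| ≤ B ξ) ∧
      ∀ ξ, Tendsto (fun n => g n ξ) atTop (𝓝 (Real.sign (α - ξ) * (f α - f ξ))) := by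
  have hf' : Continuous (deriv f) := hf.continuous_deriv le_rfl
  set T : ℕ → ℝ → ℝ := fun n t => t / (|t| + 1 / ((n : ℝ) + 1)) with hT
  have hpos (n : ℕ) (t : ℝ) : 0 < |t| + 1 / ((n : ℝ) + 1) := by positivity
  have hTc (n) : Continuous (T n) :=
    continuous_id.div (by fun_prop) fun t => (hpos n t).ne'
  have hT1 (n t) : |T n t| ≤ 1 := by
    rw [hT, abs_div, abs_of_pos (hpos n t), div_le_one (hpos n t)]
    have : 0 < 1 / ((n : ℝ) + 1) := by positivity
    linarith
  have hTlim (t) : Tendsto (fun n => T n t) atTop (𝓝 (Real.sign t)) := by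
    rcases eq_or_ne t 0 with rfl | ht
    · simp [hT]
    · have h : Tendsto (fun n : ℕ => t / (|t| + 1 / ((n : ℝ) + 1))) atTop (𝓝 (t / (|t| + 0))) :=
        tendsto_const_nhds.div (tendsto_const_nhds.add tendsto_one_div_add_atTop_nhds_zero_nat)
          (by simpa using ht)
      convert h using 2
      rcases ht.lt_or_gt with h0 | h0
      · rw [Real.sign_of_neg h0, abs_of_neg h0, add_zero, div_neg, div_self ht]
      · rw [Real.sign_of_pos h0, abs_of_pos h0, add_zero, div_self ht]
  have hc (n) : Continuous (fun s => T n (s - α) * deriv f s) := by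
    have := hTc n
    fun_prop
  have hle (n s) : |T n (s - α) * deriv f s| ≤ |deriv f s| := by
    rw [abs_mul]
    exact mul_le_of_le_one_left (abs_nonneg _) (hT1 _ _)
  have hd (n ξ) : HasDerivAt (fun ξ => ∫ s in α..ξ, T n (s - α) * deriv f s)
      (T n (ξ - α) * deriv f ξ) ξ := (hc n).integral_hasStrictDerivAt α ξ |>.hasDerivAt
  refine ⟨fun n ξ => ∫ s in α..ξ, T n (s - α) * deriv f s,
    fun ξ => |(∫ s in α..ξ, |deriv f s|)|, fun n => ?_, ?_, fun n ξ => ?_, fun n ξ => ?_,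
    fun ξ => ?_⟩
  · rw [contDiff_one_iff_deriv]
    refine ⟨fun ξ => (hd n ξ).differentiableAt, ?_⟩
    rw [funext fun ξ => (hd n ξ).deriv]
    exact hc n
  · exact (intervalIntegral.continuous_primitive
      (fun _ _ => hf'.abs.intervalIntegrable _ _) α).abs
  · rw [(hd n ξ).deriv]
    exact hle n ξ
  · exact intervalIntegral.norm_integral_le_abs_of_norm_le (f := fun s => T n (s - α) * deriv f s)
      (ae_of_all _ fun s => hle n s) (hf'.abs.intervalIntegrable _ _)
  · have hlim : Tendsto (fun n => ∫ s in α..ξ, T n (s - α) * deriv f s) atTop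
        (𝓝 (∫ s in α..ξ, Real.sign (s - α) * deriv f s)) :=
      intervalIntegral.tendsto_integral_filter_of_dominated_convergence (fun s => |deriv f s|)
        (Eventually.of_forall fun n => (hc n).aestronglyMeasurable)
        (Eventually.of_forall fun n => ae_of_all _ fun s _ => hle n s)
        (hf'.abs.intervalIntegrable _ _)
        (ae_of_all _ fun s _ => (hTlim _).mul_const _)
    have hftc : ∫ s in α..ξ, deriv f s = f ξ - f α :=
      intervalIntegral.integral_deriv_eq_sub
        (fun s _ => hf.differentiable one_ne_zero s) (hf'.intervalIntegrable _ _)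
    have hval : ∫ s in α..ξ, Real.sign (s - α) * deriv f s =
        Real.sign (ξ - α) * (f ξ - f α) := by
      rw [← hftc, ← intervalIntegral.integral_const_mul]
      rcases lt_trichotomy ξ α with h | rfl | h
      · refine intervalIntegral.integral_congr_ae ?_
        filter_upwards [Measure.ae_ne volume α] with s hs hmem
        rw [Set.uIoc_of_ge h.le] at hmem
        rw [Real.sign_of_neg (sub_neg.2 (lt_of_le_of_ne hmem.2 hs)),
          Real.sign_of_neg (sub_neg.2 h)]
      · simp
      · refine intervalIntegral.integral_congr_ae (ae_of_all _ fun s hmem => ?_)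
        rw [Set.uIoc_of_le h.le] at hmem
        rw [Real.sign_of_pos (sub_pos.2 hmem.1), Real.sign_of_pos (sub_pos.2 h)]
    rw [hval] at hlim
    convert hlim using 2
    rw [← neg_sub ξ α, Real.sign_neg]
    ring

/-- A one-sided bound for the pairing of the divergence of a compactly supported field with
`sign (α - b) * (f α - f b)`. -/
lemma integral_diverg_mul_sign_le {d : ℕ} {X : Euc d → Euc d} {b : Euc d → ℝ} {f : ℝ → ℝ}
    (hX : ContDiff ℝ 1 X) (hXc : HasCompactSupport X) (hb : ContDiff ℝ 1 b)
    (hf : ContDiff ℝ 1 f) (α : ℝ) :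
    ∫ y, diverg X y * (Real.sign (α - b y) * (f α - f (b y)))
      ≤ ∫ y, |deriv f (b y)| * (‖gradient b y‖ * ‖X y‖) := by
  obtain ⟨g, B, hg, hB, hg', hgB, hlim⟩ := exists_contDiff_tendsto_sign_mul_sub hf α
  have hdivc : Continuous (diverg X) := by
    have := hX.continuous_fderiv one_ne_zero
    unfold diverg
    fun_prop
  have hdivs : HasCompactSupport (diverg X) :=
    (hXc.fderiv ℝ).comp_left
      (g := fun A : Euc d →L[ℝ] Euc d =>
        ∑ i, ⟪A (EuclideanSpace.single i 1), EuclideanSpace.single i (1:ℝ)⟫) (by simp)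
  have hbc : Continuous (fun y => ‖gradient b y‖) := by
    simpa [gradient] using (hb.continuous_fderiv one_ne_zero).norm
  have hf' : Continuous (deriv f) := hf.continuous_deriv le_rfl
  have hconv : Tendsto (fun n => ∫ y, diverg X y * g n (b y)) atTop
      (𝓝 (∫ y, diverg X y * (Real.sign (α - b y) * (f α - f (b y))))) := by
    refine tendsto_integral_of_dominated_convergence (fun y => |diverg X y| * B (b y))
      (fun n => (hdivc.mul ((hg n).continuous.comp hb.continuous)).aestronglyMeasurable)
      ?_ (fun n => ae_of_all _ fun y => ?_) (ae_of_all _ fun y => (hlim _).const_mul _)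
    · exact (hdivc.abs.mul (hB.comp hb.continuous)).integrable_of_hasCompactSupport
        (hdivs.comp_left (g := fun t : ℝ => |t|) abs_zero).mul_right
    · rw [Real.norm_eq_abs, abs_mul]
      gcongr
      exact hgB _ _
  refine le_of_tendsto' hconv fun n => ?_
  refine (integral_diverg_mul hX hXc ((hg n).comp hb)).trans_le ?_
  rw [← integral_neg]
  have hpt (y) : -fderiv ℝ (g n ∘ b) y (X y) ≤
      |deriv f (b y)| * (‖gradient b y‖ * ‖X y‖) := by
    have hcomp : HasFDerivAt (g n ∘ b) (deriv (g n) (b y) • fderiv ℝ b y) y :=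
      (((hg n).differentiable one_ne_zero (b y)).hasDerivAt).comp_hasFDerivAt y
        (hb.differentiable one_ne_zero y).hasFDerivAt
    rw [hcomp.fderiv]
    refine (neg_le_abs _).trans ?_
    have h1 : |fderiv ℝ b y (X y)| ≤ ‖gradient b y‖ * ‖X y‖ := by
      simpa [gradient] using (fderiv ℝ b y).le_opNorm (X y)
    rw [_root_.smul_apply, smul_eq_mul, abs_mul]
    exact mul_le_mul (hg' _ _) h1 (abs_nonneg _) (abs_nonneg _)
  refine integral_mono ?_ ?_ hpt
  · refine Continuous.integrable_of_hasCompactSupport ?_ ?_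
    · exact ((((hg n).comp hb).continuous_fderiv one_ne_zero).clm_apply hX.continuous).neg
    · refine hXc.mono (Function.support_subset_iff'.2 fun y hy => ?_)
      simp [Function.notMem_support.1 hy]
  · refine Continuous.integrable_of_hasCompactSupport
      ((hf'.comp hb.continuous).abs.mul (hbc.mul hX.continuous.norm)) ?_
    exact hXc.norm.mul_left.mul_left

theorem stmt_5 (d : ℕ) (hd : 1 ≤ d) (L Ma Mb : ℝ)
    (hL : 0 < L) (hMa : 0 < Ma) (hMb : 0 < Mb)
    (V : Euc d → Euc d) (hV : ContDiff ℝ 1 V) (hVL : ∀ y, ‖fderiv ℝ V y‖ ≤ L)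
    (a : Euc d → ℝ) (hameas : Measurable a)
    (hab : ∀ᵐ x ∂(volume : Measure (Euc d)), |a x| ≤ Ma)
    (b : Euc d → ℝ) (hb : ContDiff ℝ 1 b) (hbb : ∀ y, |b y| ≤ Mb)
    (hbgrad : Integrable (fun y => gradient b y))
    (f : ℝ → ℝ) (hf : ContDiff ℝ 1 f)
    (ψ φ : Euc d → ℝ) (hψ : ContDiff ℝ 1 ψ) (hψc : HasCompactSupport ψ)
    (hφ : ContDiff ℝ 1 φ) (hφc : HasCompactSupport φ) :
    (∫ x, ∫ y,
        (⟪gradient ψ (x + y), V x - V y⟫ * φ (x - y)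
            - ψ (x + y) * ⟪gradient φ (x - y), V x - V y⟫
            - ψ (x + y) * φ (x - y) * diverg V y)
          * (Real.sign (a x - b y) * (f (a x) - f (b y))))
      ≤ (⨆ z, |ψ z|) * sSup ((fun ξ => |deriv f ξ|) '' Set.Icc (-Mb) Mb) *
          (∫ y, ‖gradient b y‖) * L * ∫ z, ‖z‖ * |φ z| := by
  have hVd := hV.differentiable one_ne_zero
  have hf' : Continuous (deriv f) := hf.continuous_deriv le_rfl
  have hbg : Continuous (fun y => ‖gradient b y‖) := by
    simpa [gradient] using (hb.continuous_fderiv one_ne_zero).norm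
  have hVlip (x y) : ‖V x - V y‖ ≤ L * ‖x - y‖ :=
    convex_univ.norm_image_sub_le_of_norm_fderiv_le (fun z _ => hVd z) (fun z _ => hVL z)
      (Set.mem_univ y) (Set.mem_univ x)
  set S := ⨆ z, |ψ z|
  set K := sSup ((fun ξ => |deriv f ξ|) '' Set.Icc (-Mb) Mb)
  have hS (z) : |ψ z| ≤ S :=
    le_ciSup (hψ.continuous.abs.bddAbove_range_of_hasCompactSupport
      (hψc.comp_left (g := fun t : ℝ => |t|) abs_zero)) z
  have hK (y) : |deriv f (b y)| ≤ K :=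
    le_csSup (isCompact_Icc.image hf'.abs).bddAbove ⟨b y, abs_le.1 (hbb y), rfl⟩
  have hS0 : 0 ≤ S := (abs_nonneg _).trans (hS 0)
  have hK0 : 0 ≤ K := (abs_nonneg _).trans (hK 0)
  set k : Euc d → ℝ := fun z => ‖z‖ * |φ z|
  have hkc : Continuous k := continuous_norm.mul hφ.continuous.abs
  have hks : HasCompactSupport k := (hφc.comp_left (g := fun t : ℝ => |t|) abs_zero).mul_left
  have hk : Integrable k := hkc.integrable_of_hasCompactSupport hks
  have hshift {E : Type} [Zero E] {h : Euc d → E} (hh : HasCompactSupport h) (x : Euc d) :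
      HasCompactSupport (fun y => h (x - y)) :=
    hh.comp_homeomorph (Homeomorph.subLeft x)
  have hinner (x) : (∫ y,
        (⟪gradient ψ (x + y), V x - V y⟫ * φ (x - y)
            - ψ (x + y) * ⟪gradient φ (x - y), V x - V y⟫
            - ψ (x + y) * φ (x - y) * diverg V y)
          * (Real.sign (a x - b y) * (f (a x) - f (b y)))) ≤
      S * K * L * ∫ y, ‖gradient b y‖ * k (x - y) := by
    simp only [← diverg_doubling hVd (hψ.differentiable one_ne_zero)
      (hφ.differentiable one_ne_zero)]
    have hXc : HasCompactSupport (fun y => (ψ (x + y) * φ (x - y)) • (V x - V y)) :=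
      (hshift hφc x).mul_left.smul_right
    have hX : ContDiff ℝ 1 (fun y => (ψ (x + y) * φ (x - y)) • (V x - V y)) := by fun_prop
    refine (integral_diverg_mul_sign_le hX hXc hb hf (a x)).trans ?_
    rw [← integral_const_mul]
    refine integral_mono ?_ ?_ fun y => ?_
    · exact ((hf'.comp hb.continuous).abs.mul (hbg.mul hX.continuous.norm)
        ).integrable_of_hasCompactSupport hXc.norm.mul_left.mul_left
    · exact ((hbg.mul (hkc.comp (continuous_sub_left x))).integrable_of_hasCompactSupport
        (hshift hks x).mul_left).const_mul _
    · have hnorm : ‖(ψ (x + y) * φ (x - y)) • (V x - V y)‖ ≤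
          S * |φ (x - y)| * (L * ‖x - y‖) := by
        rw [norm_smul, Real.norm_eq_abs, abs_mul]
        gcongr
        exacts [hS _, hVlip x y]
      calc |deriv f (b y)| * (‖gradient b y‖ * ‖(ψ (x + y) * φ (x - y)) • (V x - V y)‖)
          ≤ K * (‖gradient b y‖ * (S * |φ (x - y)| * (L * ‖x - y‖))) := by
            gcongr
            exact hK y
        _ = S * K * L * (‖gradient b y‖ * k (x - y)) := by ring
  have hconv := integral_convolution (μ := (volume : Measure (Euc d))) (ν := volume)
    (ContinuousLinearMap.mul ℝ ℝ) hbgrad.norm hk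
  have hcint := hbgrad.norm.integrable_convolution (ContinuousLinearMap.mul ℝ ℝ) hk
  simp only [convolution_def, ContinuousLinearMap.mul_apply'] at hconv
  have hcint' : Integrable (fun x => ∫ y, ‖gradient b y‖ * k (x - y)) := hcint
  have hRHS : S * K * (∫ y, ‖gradient b y‖) * L * ∫ z, k z =
      ∫ x, S * K * L * ∫ y, ‖gradient b y‖ * k (x - y) := by
    rw [integral_const_mul, hconv]
    ring
  have hk0 (z) : 0 ≤ k z := by positivity
  rw [hRHS]
  by_cases hF : Integrable (fun x => ∫ y,
        (⟪gradient ψ (x + y), V x - V y⟫ * φ (x - y)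
            - ψ (x + y) * ⟪gradient φ (x - y), V x - V y⟫
            - ψ (x + y) * φ (x - y) * diverg V y)
          * (Real.sign (a x - b y) * (f (a x) - f (b y))))
  · exact integral_mono hF (hcint'.const_mul _) hinner
  · rw [integral_undef hF]
    exact integral_nonneg fun x => mul_nonneg (by positivity)
      (integral_nonneg fun y => mul_nonneg (norm_nonneg _) (hk0 _))
end
end

section
/- (Kato's inequality for classical functions.) Let d ≥ 1, let u : ℝ^d → ℝ be twice continuously differentiable, let k ∈ ℝ, and let φ : ℝ^d → ℝ be twice continuously differentiable with compact support and φ ≥ 0. Then ∫_{ℝ^d} |u(x) − k|·Δφ(x) dx ≥ ∫_{ℝ^d} sign(u(x) − k)·Δu(x)·φ(x) dx. -/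
open MeasureTheory Real
open scoped RealInnerProductSpace

noncomputable section

theorem ContDiff.fderiv_apply_const {E : Type*} [NormedAddCommGroup E] [NormedSpace ℝ E]
    {f : E → ℝ} (hf : ContDiff ℝ 2 f) (v : E) : ContDiff ℝ 1 (fun y => fderiv ℝ f y v) :=
  (hf.fderiv_right (m := 1) (by norm_num)).clm_apply contDiff_const

theorem ContDiff.continuous_lap {d : ℕ} {f : Euc d → ℝ} (hf : ContDiff ℝ 2 f) :
    Continuous (lap f) :=
  continuous_finsetSum _ fun i _ =>
    ((hf.fderiv_apply_const (EuclideanSpace.single i 1)).continuous_fderiv one_ne_zero).clm_apply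
      continuous_const

theorem hasCompactSupport_lap {d : ℕ} {f : Euc d → ℝ} (hf : HasCompactSupport f) :
    HasCompactSupport (lap f) :=
  HasCompactSupport.intro' hf (isClosed_tsupport f) fun _ hx => Finset.sum_eq_zero fun i _ =>
    image_eq_zero_of_notMem_tsupport
      (f := fun x => fderiv ℝ (fun y => fderiv ℝ f y (EuclideanSpace.single i 1)) x
        (EuclideanSpace.single i 1))
      fun h => hx (tsupport_fderiv_apply_subset ℝ _ (tsupport_fderiv_apply_subset ℝ _ h))

/-- Integrating by parts twice in a fixed direction. -/
theorem integral_mul_fderiv_fderiv {E : Type*} [NormedAddCommGroup E] [NormedSpace ℝ E]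
    [FiniteDimensional ℝ E] [MeasurableSpace E] [BorelSpace E] {μ : Measure E}
    [μ.IsAddHaarMeasure] {f φ : E → ℝ} (hf : ContDiff ℝ 2 f) (hφ : ContDiff ℝ 2 φ)
    (hφc : HasCompactSupport φ) (v : E) :
    ∫ x, f x * fderiv ℝ (fun y => fderiv ℝ φ y v) x v ∂μ =
      ∫ x, fderiv ℝ (fun y => fderiv ℝ f y v) x v * φ x ∂μ := by
  have hf' := hf.fderiv_apply_const v
  have hφ' := hφ.fderiv_apply_const v
  have hf'' : Continuous fun x => fderiv ℝ (fun y => fderiv ℝ f y v) x v :=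
    (hf'.continuous_fderiv one_ne_zero).clm_apply continuous_const
  have hφ'' : Continuous fun x => fderiv ℝ (fun y => fderiv ℝ φ y v) x v :=
    (hφ'.continuous_fderiv one_ne_zero).clm_apply continuous_const
  have hφ'c := hφc.fderiv_apply (𝕜 := ℝ) v
  have hφ''c := hφ'c.fderiv_apply (𝕜 := ℝ) v
  rw [integral_mul_fderiv_eq_neg_fderiv_mul_of_integrable
      ((hf'.continuous.mul hφ'.continuous).integrable_of_hasCompactSupport hφ'c.mul_left)
      ((hf.continuous.mul hφ'').integrable_of_hasCompactSupport hφ''c.mul_left)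
      ((hf.continuous.mul hφ'.continuous).integrable_of_hasCompactSupport hφ'c.mul_left)
      (fun x _ => hf.differentiable two_ne_zero x) (fun x _ => hφ'.differentiable one_ne_zero x),
    integral_mul_fderiv_eq_neg_fderiv_mul_of_integrable
      ((hf''.mul hφ.continuous).integrable_of_hasCompactSupport hφc.mul_left)
      ((hf'.continuous.mul hφ'.continuous).integrable_of_hasCompactSupport hφ'c.mul_left)
      ((hf'.continuous.mul hφ.continuous).integrable_of_hasCompactSupport hφc.mul_left)
      (fun x _ => hf'.differentiable one_ne_zero x) (fun x _ => hφ.differentiable two_ne_zero x),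
    neg_neg]

/-- Green's second identity against a compactly supported function. -/
theorem integral_mul_lap {d : ℕ} {f φ : Euc d → ℝ} (hf : ContDiff ℝ 2 f) (hφ : ContDiff ℝ 2 φ)
    (hφc : HasCompactSupport φ) : ∫ x, f x * lap φ x = ∫ x, lap f x * φ x := by
  have second {g : Euc d → ℝ} (hg : ContDiff ℝ 2 g) (v : Euc d) :
      Continuous fun x => fderiv ℝ (fun y => fderiv ℝ g y v) x v :=
    ((hg.fderiv_apply_const v).continuous_fderiv one_ne_zero).clm_apply continuous_const
  simp only [lap, Finset.mul_sum, Finset.sum_mul]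
  rw [integral_finsetSum, integral_finsetSum]
  · exact Finset.sum_congr rfl fun i _ => integral_mul_fderiv_fderiv hf hφ hφc _
  · exact fun i _ => ((second hf _).mul hφ.continuous).integrable_of_hasCompactSupport hφc.mul_left
  · exact fun i _ => (hf.continuous.mul (second hφ _)).integrable_of_hasCompactSupport
      ((hφc.fderiv_apply (𝕜 := ℝ) _).fderiv_apply (𝕜 := ℝ) _).mul_left

/-- The chain rule for the Laplacian. -/
theorem lap_comp {d : ℕ} {u : Euc d → ℝ} (hu : ContDiff ℝ 2 u) {θ θ' θ'' : ℝ → ℝ}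
    (hθ : ∀ s, HasDerivAt θ (θ' s) s) (hθ' : ∀ s, HasDerivAt θ' (θ'' s) s) (x : Euc d) :
    lap (fun y => θ (u y)) x =
      θ' (u x) * lap u x + θ'' (u x) * ∑ i, fderiv ℝ u x (EuclideanSpace.single i 1) ^ 2 := by
  simp only [lap, Finset.mul_sum, ← Finset.sum_add_distrib]
  refine Finset.sum_congr rfl fun i _ => ?_
  set v : Euc d := EuclideanSpace.single i 1
  have hfirst : (fun y => fderiv ℝ (fun z => θ (u z)) y v) =
      fun y => θ' (u y) * fderiv ℝ u y v := by
    funext y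
    have := (hθ (u y)).comp_hasFDerivAt y (hu.differentiable two_ne_zero y).hasFDerivAt
    simp [show fderiv ℝ (fun z => θ (u z)) y = _ from this.fderiv]
  have hsecond := ((hθ' (u x)).comp_hasFDerivAt x (hu.differentiable two_ne_zero x).hasFDerivAt).mul
    ((hu.fderiv_apply_const v).differentiable one_ne_zero x).hasFDerivAt
  rw [hfirst, show fderiv ℝ (fun y => θ' (u y) * fderiv ℝ u y v) x = _ from hsecond.fderiv]
  simp
  ring

theorem hasDerivAt_sqrt_sq_add {ε : ℝ} (hε : 0 < ε) (k s : ℝ) :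
    HasDerivAt (fun s => √((s - k) ^ 2 + ε)) ((s - k) / √((s - k) ^ 2 + ε)) s := by
  have h : HasDerivAt (fun s => (s - k) ^ 2 + ε) (2 * (s - k)) s := by
    simpa using (((hasDerivAt_id s).sub_const k).pow 2).add_const ε
  convert h.sqrt (by positivity) using 1
  field_simp

theorem hasDerivAt_div_sqrt_sq_add {ε : ℝ} (hε : 0 < ε) (k s : ℝ) :
    HasDerivAt (fun s => (s - k) / √((s - k) ^ 2 + ε)) (ε / √((s - k) ^ 2 + ε) ^ 3) s := by
  have hpos : 0 < √((s - k) ^ 2 + ε) := by positivity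
  have hsq : √((s - k) ^ 2 + ε) ^ 2 = (s - k) ^ 2 + ε := Real.sq_sqrt (by positivity)
  refine (((hasDerivAt_id s).sub_const k).div (hasDerivAt_sqrt_sq_add hε k s)
    hpos.ne').congr_deriv ?_
  simp only [id]
  field_simp
  rw [hsq]
  ring

theorem abs_div_sqrt_sq_add_le_one {ε : ℝ} (hε : 0 ≤ ε) (a : ℝ) : |a / √(a ^ 2 + ε)| ≤ 1 := by
  rw [abs_div, abs_of_nonneg (Real.sqrt_nonneg _)]
  exact div_le_one_of_le₀ (Real.abs_le_sqrt (by linarith)) (Real.sqrt_nonneg _)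

theorem sqrt_sq_add_le {ε : ℝ} (hε : ε ≤ 1) (a : ℝ) : √(a ^ 2 + ε) ≤ |a| + 1 := by
  refine Real.sqrt_le_iff.2 ⟨by positivity, ?_⟩
  nlinarith [sq_abs a, abs_nonneg a]

theorem tendsto_sqrt_sq_add {ι : Type*} {l : Filter ι} {ε : ι → ℝ}
    (hε : Filter.Tendsto ε l (nhds 0)) (a : ℝ) :
    Filter.Tendsto (fun n => √(a ^ 2 + ε n)) l (nhds |a|) := by
  rw [← Real.sqrt_sq_eq_abs, ← add_zero (a ^ 2)]
  simpa only [add_zero] using (hε.const_add (a ^ 2)).sqrt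

theorem tendsto_div_sqrt_sq_add {ι : Type*} {l : Filter ι} {ε : ι → ℝ}
    (hε : Filter.Tendsto ε l (nhds 0)) (a : ℝ) :
    Filter.Tendsto (fun n => a / √(a ^ 2 + ε n)) l (nhds (Real.sign a)) := by
  rcases eq_or_ne a 0 with rfl | ha
  · simpa using tendsto_const_nhds
  · have hsign : Real.sign a = a / |a| := by
      rcases ha.lt_or_gt with h | h
      · rw [Real.sign_of_neg h, abs_of_neg h, div_neg, div_self ha]
      · rw [Real.sign_of_pos h, abs_of_pos h, div_self ha]
    rw [hsign]
    exact tendsto_const_nhds.div (tendsto_sqrt_sq_add hε a) (abs_ne_zero.2 ha)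

/-- Kato's inequality with `|u - k|` replaced by the smooth convex function
`√((u - k) ^ 2 + ε)`. -/
theorem integral_regularized_kato {d : ℕ} {u φ : Euc d → ℝ} (hu : ContDiff ℝ 2 u) (k : ℝ)
    (hφ : ContDiff ℝ 2 φ) (hφc : HasCompactSupport φ) (hφ0 : ∀ x, 0 ≤ φ x) {ε : ℝ} (hε : 0 < ε) :
    ∫ x, (u x - k) / √((u x - k) ^ 2 + ε) * (lap u x * φ x) ≤
      ∫ x, √((u x - k) ^ 2 + ε) * lap φ x := by
  have hsmooth : ContDiff ℝ 2 fun x => √((u x - k) ^ 2 + ε) :=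
    (((hu.sub contDiff_const).pow 2).add contDiff_const).sqrt fun x => by positivity
  have hcont : Continuous fun x => (u x - k) / √((u x - k) ^ 2 + ε) :=
    (hu.continuous.sub continuous_const).div hsmooth.continuous fun x => by positivity
  rw [integral_mul_lap hsmooth hφ hφc]
  refine integral_mono
    ((hcont.mul (hu.continuous_lap.mul hφ.continuous)).integrable_of_hasCompactSupport
      hφc.mul_left.mul_left)
    ((hsmooth.continuous_lap.mul hφ.continuous).integrable_of_hasCompactSupport hφc.mul_left)
    fun x => ?_
  dsimp only
  rw [lap_comp hu (hasDerivAt_sqrt_sq_add hε k) (hasDerivAt_div_sqrt_sq_add hε k), ← mul_assoc]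
  exact mul_le_mul_of_nonneg_right (le_add_of_nonneg_right (by positivity)) (hφ0 x)

theorem stmt_6 (d : ℕ) (hd : 1 ≤ d) (u : Euc d → ℝ) (hu : ContDiff ℝ 2 u) (k : ℝ)
    (φ : Euc d → ℝ) (hφ : ContDiff ℝ 2 φ) (hφc : HasCompactSupport φ)
    (hφ0 : ∀ x, 0 ≤ φ x) :
    ∫ x, Real.sign (u x - k) * lap u x * φ x ≤ ∫ x, |u x - k| * lap φ x := by
  simp only [mul_assoc]
  have hε : Filter.Tendsto (fun n : ℕ => 1 / ((n : ℝ) + 1)) Filter.atTop (nhds 0) :=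
    tendsto_one_div_add_atTop_nhds_zero_nat
  have hε0 (n : ℕ) : 0 < 1 / ((n : ℝ) + 1) := by positivity
  have hε1 (n : ℕ) : 1 / ((n : ℝ) + 1) ≤ 1 :=
    div_le_one_of_le₀ (by linarith [n.cast_nonneg (α := ℝ)]) (by positivity)
  have hw : Continuous fun x => u x - k := hu.continuous.sub continuous_const
  have hsqrt (n : ℕ) : Continuous fun x => √((u x - k) ^ 2 + 1 / ((n : ℝ) + 1)) :=
    ((hw.pow 2).add continuous_const).sqrt
  have hlapφ := hφ.continuous_lap
  refine le_of_tendsto_of_tendsto'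
    (tendsto_integral_of_dominated_convergence (fun x => |lap u x * φ x|) (fun n => ?_) ?_
      (fun n => .of_forall fun x => ?_)
      (.of_forall fun x => (tendsto_div_sqrt_sq_add hε (u x - k)).mul_const _))
    (tendsto_integral_of_dominated_convergence (fun x => (|u x - k| + 1) * |lap φ x|)
      (fun n => ((hsqrt n).mul hlapφ).aestronglyMeasurable) ?_
      (fun n => .of_forall fun x => ?_)
      (.of_forall fun x => (tendsto_sqrt_sq_add hε (u x - k)).mul_const _))
    fun n => integral_regularized_kato hu k hφ hφc hφ0 (hε0 n)
  · refine ((hw.div (hsqrt n) fun x => ?_).mul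
      (hu.continuous_lap.mul hφ.continuous)).aestronglyMeasurable
    have := hε0 n
    positivity
  · exact ((hu.continuous_lap.mul hφ.continuous).integrable_of_hasCompactSupport
      hφc.mul_left).abs
  · rw [norm_mul, Real.norm_eq_abs, Real.norm_eq_abs]
    exact mul_le_of_le_one_left (abs_nonneg _) (abs_div_sqrt_sq_add_le_one (hε0 n).le _)
  · exact ((hw.abs.add continuous_const).mul hlapφ.abs).integrable_of_hasCompactSupport
      ((hasCompactSupport_lap hφc).comp_left abs_zero).mul_left
  · rw [Pi.mul_apply, norm_mul, Real.norm_eq_abs, Real.norm_eq_abs, abs_of_nonneg (Real.sqrt_nonneg _)]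
    exact mul_le_mul_of_nonneg_right (sqrt_sq_add_le (hε1 n) _) (abs_nonneg _)
end
end

section
/- (Local L^∞ bound for the viscous approximation.) Let d ≥ 1, ε ≥ 0, α > 0, C₀ > 0. Let f : ℝ → ℝ be continuously differentiable with f(0) = 0 and |f(ξ)| ≤ C₀(1 + |ξ|^α) for all ξ ∈ ℝ. Let K : ℝ^d → ℝ^d be continuously differentiable, bounded, with bounded Jacobian, and with div K integrable; set D := ∫_{ℝ^d}|div K(x)|dx. There exists a constant C > 0 depending only on d, α, and C₀ with the following property. Let T > 0 and let u : [0,T] × ℝ^d → ℝ be bounded and continuous, continuously differentiable in t and twice continuously differentiable in x, with u(t,·) integrable for each t, dominated in the sense that |u(t,x)| + ‖∇_x u(t,x)‖ + |Δ_x u(t,x)| ≤ g(x) for all (t,x) for some integrable g, and satisfying pointwise on (0,T)×ℝ^d the equation ∂_t u + div_x(f(u)·(K∗u)) = ε·Δ_x u. If C·D·(1 + (sup_x|u(0,x)|)^α)·T ≤ 1, then sup_{(t,x) ∈ [0,T]×ℝ^d} |u(t,x)| ≤ 2·sup_{x ∈ ℝ^d}|u(0,x)|. -/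
open MeasureTheory Real
open scoped RealInnerProductSpace

noncomputable section

/-- The left derivative at the right end of an interval, where a maximum sits, is nonnegative. -/
lemma HasDerivAt.nonneg_of_forall_le_right_endpoint {φ : ℝ → ℝ} {φ' a b : ℝ} (hab : a < b)
    (hφ : HasDerivAt φ φ' b) (hmax : ∀ s ∈ Set.Icc a b, φ s ≤ φ b) : 0 ≤ φ' := by
  have h := (hasDerivAt_iff_tendsto_slope.1 hφ).mono_left
    (nhdsWithin_mono b (fun s (hs : s ∈ Set.Iio b) => ne_of_lt hs))
  refine ge_of_tendsto h ?_
  filter_upwards [Ioo_mem_nhdsLT hab] with s hs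
  rw [slope_def_field]
  exact div_nonneg_of_nonpos (by linarith [hmax s ⟨hs.1.le, hs.2.le⟩]) (by linarith [hs.2])

/-- A function lying below a parabola that touches it at `0` has the same slope there, and a second
derivative which is no larger. -/
lemma deriv_eq_and_second_deriv_le_of_le_parabola {φ φ' : ℝ → ℝ} {φ'' p q : ℝ}
    (hφ : ∀ s, HasDerivAt φ (φ' s) s) (hφ' : HasDerivAt φ' φ'' 0)
    (hle : ∀ s, φ s ≤ φ 0 + p * s + q * s ^ 2 / 2) : φ' 0 = p ∧ φ'' ≤ q := by
  set ψ : ℝ → ℝ := fun s => φ s - (p * s + q * s ^ 2 / 2) with hψ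
  have h1 : ∀ s, HasDerivAt ψ (φ' s - (p + q * s)) s := by
    intro s
    have hp : HasDerivAt (fun s : ℝ => p * s + q * s ^ 2 / 2) (p + q * s) s := by
      have := ((hasDerivAt_id s).const_mul p).add
        ((((hasDerivAt_id s).pow 2).const_mul q).div_const 2)
      exact this.congr_deriv (by simp; ring)
    exact (hφ s).sub hp
  have hd : deriv ψ = fun s => φ' s - (p + q * s) := funext fun s => (h1 s).deriv
  have h2 : HasDerivAt (deriv ψ) (φ'' - q) 0 := by
    rw [hd]
    have hp : HasDerivAt (fun s : ℝ => p + q * s) q 0 := by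
      simpa using ((hasDerivAt_id (0 : ℝ)).const_mul q).const_add p
    exact hφ'.sub hp
  have hmax : IsLocalMax ψ 0 := Filter.Eventually.of_forall fun s => by
    have := hle s
    simp only [hψ]
    linarith
  have h0 : deriv ψ 0 = 0 := hmax.deriv_eq_zero
  refine ⟨by rw [hd] at h0; simpa [sub_eq_zero] using h0, ?_⟩
  by_contra! hlt
  have hmin : IsLocalMin ψ 0 :=
    isLocalMin_of_deriv_deriv_pos (by rw [h2.deriv]; linarith) h0 (h1 0).continuousAt
  have hconst : ψ =ᶠ[nhds 0] fun _ => ψ 0 := by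
    filter_upwards [hmax, hmin] with s hs hs' using le_antisymm hs hs'
  have h3 : deriv (deriv ψ) 0 = 0 := by
    rw [hconst.deriv.deriv_eq]
    simp
  rw [h2.deriv] at h3
  linarith

lemma sqrt_one_add_sq_add_le (x s : ℝ) :
    √(1 + (x + s) ^ 2) ≤ √(1 + x ^ 2) + x / √(1 + x ^ 2) * s + s ^ 2 / 2 := by
  set r := √(1 + x ^ 2) with hr
  have hr2 : r ^ 2 = 1 + x ^ 2 := Real.sq_sqrt (by positivity)
  have hr1 : 1 ≤ r := Real.one_le_sqrt.2 (by nlinarith [sq_nonneg x])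
  have hr0 : 0 < r := by linarith
  have h1 : √(1 + (x + s) ^ 2) ≤ r + (2 * x * s + s ^ 2) / (2 * r) := by
    have hq := Real.sq_sqrt (show 0 ≤ 1 + (x + s) ^ 2 by positivity)
    set q := √(1 + (x + s) ^ 2)
    have : r + (2 * x * s + s ^ 2) / (2 * r) = (r ^ 2 + q ^ 2) / (2 * r) := by
      field_simp
      rw [hq]
      nlinarith
    rw [this, le_div_iff₀ (by positivity)]
    nlinarith [sq_nonneg (q - r)]
  have h2 : (2 * x * s + s ^ 2) / (2 * r) = x / r * s + s ^ 2 / (2 * r) := by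
    field_simp
  have h3 : s ^ 2 / (2 * r) ≤ s ^ 2 / 2 :=
    div_le_div_of_nonneg_left (sq_nonneg s) (by norm_num) (by linarith)
  linarith

lemma abs_div_sqrt_one_add_sq_le_one (x : ℝ) : |x / √(1 + x ^ 2)| ≤ 1 := by
  rw [abs_div, abs_of_nonneg (Real.sqrt_nonneg _)]
  refine div_le_one_of_le₀ (Real.abs_le_sqrt (by linarith)) (Real.sqrt_nonneg _)

/-- A smooth weight on `ℝ^d` with bounded first and second derivatives, tending to infinity. -/
def penalty {d : ℕ} (x : Euc d) : ℝ := ∑ i, √(1 + x i ^ 2)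

lemma penalty_nonneg {d : ℕ} (x : Euc d) : 0 ≤ penalty x :=
  Finset.sum_nonneg fun _ _ => Real.sqrt_nonneg _

lemma continuous_penalty {d : ℕ} : Continuous (penalty : Euc d → ℝ) := by
  unfold penalty
  fun_prop

lemma norm_le_penalty {d : ℕ} (x : Euc d) : ‖x‖ ≤ penalty x := by
  rw [EuclideanSpace.norm_eq, Real.sqrt_le_left (penalty_nonneg x)]
  calc ∑ i, ‖x i‖ ^ 2 ≤ ∑ i, √(1 + x i ^ 2) ^ 2 := by
        gcongr with i
        exact Real.abs_le_sqrt (by linarith)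
    _ ≤ (∑ i, √(1 + x i ^ 2)) ^ 2 :=
        Finset.sum_sq_le_sq_sum_of_nonneg fun _ _ => Real.sqrt_nonneg _

lemma penalty_add_single_le {d : ℕ} (x : Euc d) (i : Fin d) (s : ℝ) :
    penalty (x + s • EuclideanSpace.single i (1 : ℝ)) ≤
      penalty x + x i / √(1 + x i ^ 2) * s + s ^ 2 / 2 := by
  unfold penalty
  rw [← Finset.add_sum_erase _ _ (Finset.mem_univ i),
    ← Finset.add_sum_erase _ (fun j => √(1 + x j ^ 2)) (Finset.mem_univ i)]
  have h : ∑ j ∈ Finset.univ.erase i,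
      √(1 + (x + s • EuclideanSpace.single i (1 : ℝ)) j ^ 2) =
      ∑ j ∈ Finset.univ.erase i, √(1 + x j ^ 2) := by
    refine Finset.sum_congr rfl fun j hj => ?_
    simp [Finset.ne_of_mem_erase hj]
  rw [h]
  have := sqrt_one_add_sq_add_le (x i) s
  simp only [PiLp.add_apply, PiLp.smul_apply, PiLp.single_apply, if_true, smul_eq_mul, mul_one]
  linarith

/-- First and second order conditions at a maximum of `v - δ * penalty`. -/
lemma abs_fderiv_le_and_lap_le_of_le_penalty {d : ℕ} {v : Euc d → ℝ} (hv : ContDiff ℝ 2 v)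
    {δ : ℝ} (hδ : 0 ≤ δ) {x : Euc d}
    (hmax : ∀ y, v y - δ * penalty y ≤ v x - δ * penalty x) :
    (∀ i, |fderiv ℝ v x (EuclideanSpace.single i 1)| ≤ δ) ∧ lap v x ≤ d * δ := by
  have key : ∀ i, fderiv ℝ v x (EuclideanSpace.single i 1) = δ * (x i / √(1 + x i ^ 2)) ∧
      fderiv ℝ (fun y => fderiv ℝ v y (EuclideanSpace.single i 1)) x
        (EuclideanSpace.single i 1) ≤ δ := by
    intro i
    set e : Euc d := EuclideanSpace.single i 1 with he
    have hline : ∀ s : ℝ, HasDerivAt (fun s : ℝ => x + s • e) e s := fun s => by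
      simpa using ((hasDerivAt_id s).smul_const e).const_add x
    have hv1 : Differentiable ℝ v := hv.differentiable (by norm_num)
    have hv2 : Differentiable ℝ (fun y => fderiv ℝ v y e) := by
      have : ContDiff ℝ 1 (fderiv ℝ v) := hv.fderiv_right (by norm_num)
      exact (this.differentiable (by norm_num)).clm_apply (differentiable_const e)
    have h1 : ∀ s : ℝ, HasDerivAt (fun s => v (x + s • e)) (fderiv ℝ v (x + s • e) e) s :=
      fun s => (hv1 (x + s • e)).hasFDerivAt.comp_hasDerivAt s (hline s)
    have h2 : HasDerivAt (fun s : ℝ => fderiv ℝ v (x + s • e) e)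
        (fderiv ℝ (fun y => fderiv ℝ v y e) (x + (0 : ℝ) • e) e) 0 :=
      HasFDerivAt.comp_hasDerivAt (l := fun y => fderiv ℝ v y e) (f := fun s : ℝ => x + s • e) 0
        (hv2 (x + (0 : ℝ) • e)).hasFDerivAt (hline 0)
    have h3 := deriv_eq_and_second_deriv_le_of_le_parabola
      (p := δ * (x i / √(1 + x i ^ 2))) (q := δ) h1 h2 (fun s => by
        have ha := hmax (x + s • e)
        have hb := mul_le_mul_of_nonneg_left (penalty_add_single_le x i s) hδ
        simp only [zero_smul, add_zero]
        rw [← he] at hb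
        linarith)
    simpa using h3
  constructor
  · intro i
    rw [(key i).1, abs_mul, abs_of_nonneg hδ]
    exact mul_le_of_le_one_right hδ (abs_div_sqrt_one_add_sq_le_one _)
  · calc lap v x ≤ ∑ _i : Fin d, δ := Finset.sum_le_sum fun i _ => (key i).2
      _ = d * δ := by simp

/-- Maximum principle for bounded subsolutions of a linear parabolic inequality with bounded drift
on the whole space, away from the final time. -/
lemma le_add_mul_of_parabolic_ineq_of_lt {d : ℕ} {a b c ε A L S B : ℝ} (hε : 0 ≤ ε) (hA : 0 ≤ A)
    (hac : a ≤ c) (hcb : c < b) {v vt : ℝ → Euc d → ℝ}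
    (hB : ∀ t ∈ Set.Icc a b, ∀ x, |v t x| ≤ B)
    (hcont : ContinuousOn (fun p : ℝ × Euc d => v p.1 p.2) (Set.Icc a b ×ˢ Set.univ))
    (hderiv : ∀ t ∈ Set.Ioo a b, ∀ x, HasDerivAt (fun τ => v τ x) (vt t x) t)
    (hC2 : ∀ t ∈ Set.Ioo a b, ContDiff ℝ 2 (v t))
    (hineq : ∀ t ∈ Set.Ioo a b, ∀ x, vt t x ≤
      A * ∑ i, |fderiv ℝ (v t) x (EuclideanSpace.single i 1)| + L + ε * lap (v t) x)
    (h0 : ∀ x, v a x ≤ S) : ∀ t ∈ Set.Icc a c, ∀ x, v t x ≤ S + L * (t - a) := by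
  intro t ht x
  set Λ : ℝ := A * d + ε * d + 1 with hΛ
  have hsub : Set.Icc a c ⊆ Set.Icc a b := Set.Icc_subset_Icc_right hcb.le
  have main : ∀ δ > 0, v t x ≤ S + L * (t - a) + δ * (Λ * (t - a) + penalty x) := by
    intro δ hδ
    set w : ℝ × Euc d → ℝ :=
      fun p => v p.1 p.2 - L * (p.1 - a) - δ * (Λ * (p.1 - a) + penalty p.2) with hw
    have hwc : ContinuousOn w (Set.Icc a c ×ˢ Set.univ) := by
      refine ((hcont.mono (Set.prod_mono hsub subset_rfl)).sub ?_).sub ?_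
      · fun_prop
      · have := continuous_penalty (d := d)
        fun_prop
    have hΛ0 : 0 ≤ Λ := by positivity
    obtain ⟨R, hR⟩ : ∃ R : ℝ, B + |L| * (c - a) - δ * R ≤ w (a, 0) :=
      ⟨(B + |L| * (c - a) - w (a, 0)) / δ, by field_simp; linarith⟩
    obtain ⟨⟨t₀, x₀⟩, hp, hmax⟩ := hwc.exists_isMaxOn' (isClosed_Icc.prod isClosed_univ)
      (x₀ := (a, 0)) ⟨⟨le_rfl, hac⟩, trivial⟩ (by
        rw [Filter.eventually_inf_principal]
        refine Filter.mem_of_superset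
          ((isCompact_Icc (a := a) (b := c)).prod
            (isCompact_closedBall (0 : Euc d) R)).compl_mem_cocompact ?_
        rintro ⟨τ, y⟩ hy ⟨hτ, -⟩
        have hyR : R < ‖y‖ := by
          by_contra! hle
          exact hy ⟨hτ, by simpa using hle⟩
        have h1 := (abs_le.1 (hB τ (hsub hτ) y)).2
        have h2 : -(L * (τ - a)) ≤ |L| * (c - a) := by
          have : 0 ≤ τ - a := by linarith [hτ.1]
          calc -(L * (τ - a)) = -L * (τ - a) := by ring
            _ ≤ |L| * (τ - a) := by gcongr; exact neg_le_abs L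
            _ ≤ |L| * (c - a) := by gcongr; exact hτ.2
        have h3 : δ * R ≤ δ * (Λ * (τ - a) + penalty y) := by
          have : 0 ≤ Λ * (τ - a) := mul_nonneg hΛ0 (by linarith [hτ.1])
          gcongr
          linarith [norm_le_penalty y]
        show w (τ, y) ≤ w (a, 0)
        simp only [hw] at hR ⊢
        linarith)
    have hmax' : ∀ τ ∈ Set.Icc a c, ∀ y, w (τ, y) ≤ w (t₀, x₀) :=
      fun τ hτ y => hmax (show (τ, y) ∈ Set.Icc a c ×ˢ Set.univ from ⟨hτ, trivial⟩)
    have ht₀ : t₀ ∈ Set.Icc a c := hp.1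
    rcases ht₀.1.eq_or_lt with h | hlt
    · have h1 := hmax' t ht x
      have h2 := h0 x₀
      have h3 := mul_nonneg hδ.le (penalty_nonneg x₀)
      simp only [hw, ← h, sub_self, mul_zero, zero_add, sub_zero] at h1
      linarith
    · exfalso
      have htI : t₀ ∈ Set.Ioo a b := ⟨hlt, ht₀.2.trans_lt hcb⟩
      have htime : 0 ≤ vt t₀ x₀ - (L + δ * Λ) := by
        refine HasDerivAt.nonneg_of_forall_le_right_endpoint
          (φ := fun τ => v τ x₀ - (L + δ * Λ) * (τ - a)) hlt ?_ ?_
        · have : HasDerivAt (fun τ : ℝ => (L + δ * Λ) * (τ - a)) (L + δ * Λ) t₀ := by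
            simpa using ((hasDerivAt_id t₀).sub_const a).const_mul (L + δ * Λ)
          exact (hderiv t₀ htI x₀).sub this
        · intro s hs
          have := hmax' s ⟨hs.1, hs.2.trans ht₀.2⟩ x₀
          simp only [hw] at this
          linarith
      obtain ⟨hg, hl⟩ := abs_fderiv_le_and_lap_le_of_le_penalty (hC2 t₀ htI) hδ.le (x := x₀)
        (fun y => by
          have := hmax' t₀ ht₀ y
          simp only [hw] at this
          linarith)
      have h1 := hineq t₀ htI x₀
      have h2 : ∑ i, |fderiv ℝ (v t₀) x₀ (EuclideanSpace.single i 1)| ≤ d * δ := by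
        calc _ ≤ ∑ _i : Fin d, δ := Finset.sum_le_sum fun i _ => hg i
          _ = d * δ := by simp
      have h3 := mul_le_mul_of_nonneg_left h2 hA
      have h4 := mul_le_mul_of_nonneg_left hl hε
      have h5 : δ * Λ = A * (d * δ) + ε * (d * δ) + δ := by rw [hΛ]; ring
      linarith
  refine le_of_forall_pos_le_add fun η hη => ?_
  have hq : 0 ≤ Λ * (t - a) + penalty x :=
    add_nonneg (mul_nonneg (by positivity) (by linarith [ht.1])) (penalty_nonneg x)
  set q := Λ * (t - a) + penalty x
  have h1 := main (η / (q + 1)) (by positivity)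
  have h2 : η / (q + 1) * q ≤ η := by
    rw [div_mul_eq_mul_div, div_le_iff₀ (by positivity)]
    nlinarith
  linarith

/-- Maximum principle for bounded subsolutions of a linear parabolic inequality with bounded drift
on the whole space. -/
lemma le_add_mul_of_parabolic_ineq {d : ℕ} {a b ε A L S B : ℝ} (hε : 0 ≤ ε) (hA : 0 ≤ A)
    {v vt : ℝ → Euc d → ℝ}
    (hB : ∀ t ∈ Set.Icc a b, ∀ x, |v t x| ≤ B)
    (hcont : ContinuousOn (fun p : ℝ × Euc d => v p.1 p.2) (Set.Icc a b ×ˢ Set.univ))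
    (hderiv : ∀ t ∈ Set.Ioo a b, ∀ x, HasDerivAt (fun τ => v τ x) (vt t x) t)
    (hC2 : ∀ t ∈ Set.Ioo a b, ContDiff ℝ 2 (v t))
    (hineq : ∀ t ∈ Set.Ioo a b, ∀ x, vt t x ≤
      A * ∑ i, |fderiv ℝ (v t) x (EuclideanSpace.single i 1)| + L + ε * lap (v t) x)
    (h0 : ∀ x, v a x ≤ S) : ∀ t ∈ Set.Icc a b, ∀ x, v t x ≤ S + L * (t - a) := by
  intro t ht x
  rcases ht.1.eq_or_lt with rfl | hat
  · simpa using h0 x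
  have hbt : ∀ s ∈ Set.Ico a b, v s x ≤ S + L * (s - a) := fun s hs =>
    le_add_mul_of_parabolic_ineq_of_lt hε hA hs.1 hs.2 hB hcont hderiv hC2 hineq h0 s
      ⟨hs.1, le_rfl⟩ x
  have hab : a < b := hat.trans_le ht.2
  have hc : ContinuousOn (fun s => v s x) (closure (Set.Ico a b)) := by
    rw [closure_Ico hab.ne]
    exact hcont.comp (f := fun s : ℝ => (s, x)) (by fun_prop) fun s hs => ⟨hs, trivial⟩
  exact le_on_closure hbt hc (by fun_prop) (by rwa [closure_Ico hab.ne])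

lemma hasFDerivAt_integral_smul_sub {d : ℕ} {K : Euc d → Euc d} (hK : ContDiff ℝ 1 K)
    {MK MJ : ℝ} (hMK : ∀ x, ‖K x‖ ≤ MK) (hMJ : ∀ x, ‖fderiv ℝ K x‖ ≤ MJ)
    {w : Euc d → ℝ} (hw : Integrable w) (x : Euc d) :
    Integrable (fun y => w y • fderiv ℝ K (x - y)) ∧
    HasFDerivAt (fun z => ∫ y, w y • K (z - y)) (∫ y, w y • fderiv ℝ K (x - y)) x := by
  have hK' : Continuous (fderiv ℝ K) := hK.continuous_fderiv (by norm_num)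
  have hKc : Continuous K := hK.continuous
  have hm : ∀ z, AEStronglyMeasurable (fun y => w y • K (z - y)) := fun z =>
    hw.aestronglyMeasurable.smul (by fun_prop : Continuous fun y => K (z - y)).aestronglyMeasurable
  have hm' : AEStronglyMeasurable (fun y => w y • fderiv ℝ K (x - y)) :=
    hw.aestronglyMeasurable.smul
      (by fun_prop : Continuous fun y => fderiv ℝ K (x - y)).aestronglyMeasurable
  have hbd : ∀ z y, ‖w y • fderiv ℝ K (z - y)‖ ≤ ‖w y‖ * MJ := fun z y => by
    rw [norm_smul]
    exact mul_le_mul_of_nonneg_left (hMJ _) (norm_nonneg _)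
  refine ⟨(hw.norm.mul_const MJ).mono' hm' (.of_forall (hbd x)), ?_⟩
  refine hasFDerivAt_integral_of_dominated_of_fderiv_le (bound := fun y => ‖w y‖ * MJ)
    Filter.univ_mem (.of_forall hm) ?_ hm' (.of_forall fun y z _ => hbd z y)
    (hw.norm.mul_const MJ) (.of_forall fun y z _ => ?_)
  · refine (hw.norm.mul_const MK).mono' (hm x) (.of_forall fun y => ?_)
    rw [norm_smul]
    exact mul_le_mul_of_nonneg_left (hMK _) (norm_nonneg _)
  · have h := ((hK.differentiable (by norm_num)) (z - y)).hasFDerivAt.comp z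
      ((hasFDerivAt_id z).sub_const y)
    exact h.const_smul (w y)

/-- The divergence of `K ∗ w` is bounded by `‖w‖_∞ ‖div K‖_1`. -/
lemma abs_diverg_integral_smul_sub_le {d : ℕ} {K : Euc d → Euc d} (hK : ContDiff ℝ 1 K)
    {MK MJ : ℝ} (hMK : ∀ x, ‖K x‖ ≤ MK) (hMJ : ∀ x, ‖fderiv ℝ K x‖ ≤ MJ)
    (hdiv : Integrable fun x => diverg K x)
    {w : Euc d → ℝ} (hw : Integrable w) {B : ℝ} (hB : ∀ x, |w x| ≤ B) (x : Euc d) :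
    |diverg (fun z => ∫ y, w y • K (z - y)) x| ≤ B * ∫ x, |diverg K x| := by
  obtain ⟨hint, hder⟩ := hasFDerivAt_integral_smul_sub hK hMK hMJ hw x
  have hi : ∀ i : Fin d, Integrable fun y =>
      ⟪(w y • fderiv ℝ K (x - y)) (EuclideanSpace.single i 1),
        EuclideanSpace.single i (1 : ℝ)⟫ := fun i =>
    (hint.apply_continuousLinearMap _).inner_const _
  have heq : diverg (fun z => ∫ y, w y • K (z - y)) x = ∫ y, w y * diverg K (x - y) := by
    unfold diverg
    rw [hder.fderiv]
    calc _ = ∑ i, ∫ y, ⟪(w y • fderiv ℝ K (x - y)) (EuclideanSpace.single i 1),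
            EuclideanSpace.single i (1 : ℝ)⟫ := by
          refine Finset.sum_congr rfl fun i _ => ?_
          rw [ContinuousLinearMap.integral_apply hint, real_inner_comm,
            ← integral_inner (hint.apply_continuousLinearMap _)]
          simp only [real_inner_comm]
      _ = _ := by
          rw [← integral_finsetSum _ fun i _ => hi i]
          simp only [smul_apply, real_inner_smul_left, Finset.mul_sum]
  rw [heq]
  calc |∫ y, w y * diverg K (x - y)| ≤ ∫ y, B * |diverg K (x - y)| := by
        refine norm_integral_le_of_norm_le (f := fun y => w y * diverg K (x - y))
          ((hdiv.comp_sub_left x).abs.const_mul B) (.of_forall fun y => ?_)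
        rw [norm_mul]
        exact mul_le_mul_of_nonneg_right (hB y) (abs_nonneg _)
    _ = B * ∫ x, |diverg K x| := by
        rw [integral_const_mul, integral_sub_left_eq_self (fun y => |diverg K y|) volume x]

lemma norm_integral_smul_sub_le {d : ℕ} {K : Euc d → Euc d} {MK : ℝ} (hMK : ∀ x, ‖K x‖ ≤ MK)
    {w g : Euc d → ℝ} (hg : Integrable g) (hwg : ∀ x, |w x| ≤ g x) (x : Euc d) :
    ‖∫ y, w y • K (x - y)‖ ≤ (∫ y, g y) * MK := by
  rw [← integral_mul_const]
  refine norm_integral_le_of_norm_le (hg.mul_const MK) (.of_forall fun y => ?_)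
  rw [norm_smul]
  exact mul_le_mul (hwg y) (hMK _) (norm_nonneg _) ((abs_nonneg _).trans (hwg y))

lemma diverg_smul_s13 {d : ℕ} {φ : Euc d → ℝ} {V : Euc d → Euc d} {x : Euc d}
    (hφ : DifferentiableAt ℝ φ x) (hV : DifferentiableAt ℝ V x) :
    diverg (fun z => φ z • V z) x =
      ∑ i, fderiv ℝ φ x (EuclideanSpace.single i 1) * V x i + φ x * diverg V x := by
  unfold diverg
  rw [fderiv_fun_smul hφ hV, Finset.mul_sum, ← Finset.sum_add_distrib]
  refine Finset.sum_congr rfl fun i _ => ?_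
  simp [inner_add_left, EuclideanSpace.inner_single_right]
  ring

lemma lap_neg {d : ℕ} (w : Euc d → ℝ) (x : Euc d) : lap (fun y => -w y) x = -lap w x := by
  simp [lap, fderiv_fun_neg]

/-- If `|u| ≤ B` on a time interval, then the supremum of `|u|` grows at most linearly there. -/
lemma abs_le_add_of_viscous_nonlocal {d : ℕ} {α C₀ : ℝ} (hα : 0 < α) (hC₀ : 0 < C₀)
    {ε : ℝ} (hε : 0 ≤ ε) {f : ℝ → ℝ} (hf : ContDiff ℝ 1 f)
    (hfb : ∀ ξ : ℝ, |f ξ| ≤ C₀ * (1 + |ξ| ^ α))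
    {K : Euc d → Euc d} (hK : ContDiff ℝ 1 K) {MK MJ : ℝ}
    (hMK : ∀ x, ‖K x‖ ≤ MK) (hMJ : ∀ x, ‖fderiv ℝ K x‖ ≤ MJ)
    (hdiv : Integrable (fun x => diverg K x))
    {a b : ℝ} {u ut : ℝ → Euc d → ℝ} {g : Euc d → ℝ} {B S : ℝ}
    (hB : ∀ t ∈ Set.Icc a b, ∀ x, |u t x| ≤ B)
    (hcont : ContinuousOn (fun p : ℝ × Euc d => u p.1 p.2) (Set.Icc a b ×ˢ Set.univ))
    (hderiv : ∀ t ∈ Set.Ioo a b, ∀ x, HasDerivAt (fun τ => u τ x) (ut t x) t)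
    (hC2 : ∀ t ∈ Set.Icc a b, ContDiff ℝ 2 (u t))
    (hint : ∀ t ∈ Set.Icc a b, Integrable (u t)) (hg : Integrable g)
    (hug : ∀ t ∈ Set.Icc a b, ∀ x, |u t x| ≤ g x)
    (heq : ∀ t ∈ Set.Ioo a b, ∀ x,
      ut t x + diverg (fun z => f (u t z) • ∫ y, u t y • K (z - y)) x = ε * lap (u t) x)
    (h0 : ∀ x, |u a x| ≤ S) :
    ∀ t ∈ Set.Icc a b, ∀ x,
      |u t x| ≤ S + C₀ * (1 + B ^ α) * (B * ∫ x, |diverg K x|) * (t - a) := by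
  obtain ⟨Cf, hCf⟩ := (isCompact_Icc (a := -B) (b := B)).exists_bound_of_continuousOn
    (hf.continuous_deriv (by norm_num)).continuousOn
  set L := C₀ * (1 + B ^ α) * (B * ∫ x, |diverg K x|) with hL
  set A := |Cf| * |(∫ y, g y) * MK| with hA
  have hsub := Set.Ioo_subset_Icc_self (a := a) (b := b)
  have hbound : ∀ t ∈ Set.Ioo a b, ∀ x, |ut t x - ε * lap (u t) x| ≤
      A * ∑ i, |fderiv ℝ (u t) x (EuclideanSpace.single i 1)| + L := by
    intro t ht x
    have hu1 : DifferentiableAt ℝ (u t) x := (hC2 t (hsub ht)).differentiable (by norm_num) x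
    have hf1 : HasDerivAt f (deriv f (u t x)) (u t x) :=
      (hf.differentiable (by norm_num) (u t x)).hasDerivAt
    have hfu : HasFDerivAt (fun z => f (u t z)) (deriv f (u t x) • fderiv ℝ (u t) x) x :=
      hf1.comp_hasFDerivAt x hu1.hasFDerivAt
    have hV := (hasFDerivAt_integral_smul_sub hK hMK hMJ (hint t (hsub ht)) x).2
    have h1 : ut t x - ε * lap (u t) x =
        -diverg (fun z => f (u t z) • ∫ y, u t y • K (z - y)) x := by
      linarith [heq t ht x]
    have hux := hB t (hsub ht) x
    rw [h1, abs_neg, diverg_smul_s13 hfu.differentiableAt hV.differentiableAt, hfu.fderiv]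
    refine (abs_add_le _ _).trans (add_le_add ?_ ?_)
    · rw [Finset.mul_sum]
      refine (Finset.abs_sum_le_sum_abs _ _).trans (Finset.sum_le_sum fun i _ => ?_)
      have hVi : |(∫ y, u t y • K (x - y)) i| ≤ |(∫ y, g y) * MK| :=
        ((PiLp.norm_apply_le (∫ y, u t y • K (x - y)) i).trans
          (norm_integral_smul_sub_le hMK hg (hug t (hsub ht)) x)).trans (le_abs_self _)
      have hd : |deriv f (u t x)| ≤ |Cf| := (hCf _ (abs_le.1 hux)).trans (le_abs_self _)
      rw [smul_apply, smul_eq_mul, abs_mul, abs_mul, hA]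
      calc _ ≤ |Cf| * |fderiv ℝ (u t) x (EuclideanSpace.single i 1)| * |(∫ y, g y) * MK| := by
            gcongr
        _ = _ := by ring
    · rw [abs_mul]
      have hfx : |f (u t x)| ≤ C₀ * (1 + B ^ α) := (hfb _).trans (by gcongr)
      exact mul_le_mul hfx
        (abs_diverg_integral_smul_sub_le hK hMK hMJ hdiv (hint t (hsub ht)) (hB t (hsub ht)) x)
        (abs_nonneg _) ((abs_nonneg _).trans hfx)
  have hA0 : 0 ≤ A := by positivity
  intro t ht x
  rw [abs_le']
  constructor
  · refine le_add_mul_of_parabolic_ineq hε hA0 hB hcont hderiv (fun t ht => hC2 t (hsub ht))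
      (fun t ht x => ?_) (fun x => (le_abs_self _).trans (h0 x)) t ht x
    linarith [(abs_le.1 (hbound t ht x)).2]
  · refine le_add_mul_of_parabolic_ineq (v := fun t x => -u t x) (vt := fun t x => -ut t x) hε hA0
      (fun t ht x => by simpa using hB t ht x) hcont.neg (fun t ht x => (hderiv t ht x).neg)
      (fun t ht => (hC2 t (hsub ht)).neg)
      (fun t ht x => ?_) (fun x => (neg_le_abs _).trans (h0 x)) t ht x
    rw [lap_neg]
    simp only [fderiv_fun_neg, neg_apply, abs_neg]
    linarith [(abs_le.1 (hbound t ht x)).1]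

/-- A bound that grows at most linearly at a rate controlled by a priori bounds does not double,
as long as the rate associated with twice the initial size is small. -/
lemma le_two_mul_of_linear_growth {X : Type*} {T M Mu : ℝ} {rate : ℝ → ℝ} {v : ℝ → X → ℝ}
    (hM : 0 < M) (hMu : ∀ t ∈ Set.Icc 0 T, ∀ x, v t x ≤ Mu)
    (h0 : ∀ x, v 0 x ≤ M)
    (hgrow : ∀ a b B S, 0 ≤ a → b ≤ T → (∀ t ∈ Set.Icc a b, ∀ x, v t x ≤ B) →
      (∀ x, v a x ≤ S) → ∀ t ∈ Set.Icc a b, ∀ x, v t x ≤ S + rate B * (t - a))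
    (hrate0 : 0 ≤ rate (2 * M)) (hrate : rate (2 * M) * T ≤ M / 2) :
    ∀ t ∈ Set.Icc 0 T, ∀ x, v t x ≤ 2 * M := by
  obtain ⟨h, hh, hhM⟩ : ∃ h > 0, |rate Mu| * h ≤ M / 2 :=
    ⟨M / 2 / (|rate Mu| + 1), by positivity, by
      rw [← mul_div_assoc, div_le_iff₀ (by positivity)]
      nlinarith [abs_nonneg (rate Mu)]⟩
  have key : ∀ n : ℕ, ∀ t ∈ Set.Icc 0 T, t ≤ n * h → ∀ x, v t x ≤ 2 * M := by
    intro n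
    induction n with
    | zero =>
      intro t ht htn x
      have : t = 0 := le_antisymm (by simpa using htn) ht.1
      subst this
      linarith [h0 x]
    | succ n ih =>
      intro t ht htn x
      rcases le_total t (n * h) with hle | hle
      · exact ih t ht hle x
      have hn0 : 0 ≤ n * h := by positivity
      have hnT : n * h ≤ T := hle.trans ht.2
      have h1 : ∀ x, v (n * h) x ≤ M + M / 2 := fun x => by
        have := hgrow 0 (n * h) (2 * M) M le_rfl hnT
          (fun s hs => ih s ⟨hs.1, hs.2.trans hnT⟩ hs.2) h0 (n * h) ⟨hn0, le_rfl⟩ x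
        have h2 := mul_le_mul_of_nonneg_left hnT hrate0
        rw [sub_zero] at this
        linarith
      have h2 := hgrow (n * h) T Mu (M + M / 2) hn0 le_rfl
        (fun s hs => hMu s ⟨hn0.trans hs.1, hs.2⟩) h1 t ⟨hle, ht.2⟩ x
      have h3 : rate Mu * (t - n * h) ≤ |rate Mu| * h := by
        have : t - n * h ≤ h := by push_cast at htn; linarith
        have h0' : 0 ≤ t - n * h := by linarith
        gcongr
        exact le_abs_self _
      linarith
  intro t ht x
  obtain ⟨n, hn⟩ := exists_nat_ge (t / h)
  exact key n t ht ((div_le_iff₀ hh).1 hn) x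

lemma two_mul_add_rpow_le {α M δ : ℝ} (hα : 0 < α) (hM : 0 ≤ M) (hδ : 0 ≤ δ) (hδ1 : δ ≤ 1) :
    1 + (2 * (M + δ)) ^ α ≤ (1 + 4 ^ α) * (1 + M ^ α) := by
  have h4 : (0 : ℝ) ≤ 4 ^ α := by positivity
  have hMα : 0 ≤ M ^ α := by positivity
  have h : (2 * (M + δ)) ^ α ≤ 4 ^ α * (1 + M ^ α) := by
    rcases le_total M 1 with h1 | h1
    · calc (2 * (M + δ)) ^ α ≤ 4 ^ α := by gcongr; linarith
        _ ≤ _ := by nlinarith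
    · calc (2 * (M + δ)) ^ α ≤ (4 * M) ^ α :=
          Real.rpow_le_rpow (by positivity) (by linarith) hα.le
        _ = 4 ^ α * M ^ α := Real.mul_rpow (by norm_num) hM
        _ ≤ _ := by nlinarith
  nlinarith

theorem stmt_13 (d : ℕ) (hd : 1 ≤ d) (α C₀ : ℝ) (hα : 0 < α) (hC₀ : 0 < C₀) :
    ∃ C : ℝ, 0 < C ∧
      ∀ (ε : ℝ), 0 ≤ ε →
      ∀ (f : ℝ → ℝ), ContDiff ℝ 1 f → f 0 = 0 →
        (∀ ξ : ℝ, |f ξ| ≤ C₀ * (1 + |ξ| ^ α)) →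
      ∀ (K : Euc d → Euc d), ContDiff ℝ 1 K →
        (∃ MK : ℝ, ∀ x, ‖K x‖ ≤ MK) → (∃ MJ : ℝ, ∀ x, ‖fderiv ℝ K x‖ ≤ MJ) →
        Integrable (fun x => diverg K x) →
      ∀ (T : ℝ), 0 < T →
      ∀ (u ut : ℝ → Euc d → ℝ) (g : Euc d → ℝ) (Mu : ℝ),
        (∀ t ∈ Set.Icc (0:ℝ) T, ∀ x, |u t x| ≤ Mu) →
        ContinuousOn (fun p : ℝ × Euc d => u p.1 p.2) (Set.Icc 0 T ×ˢ Set.univ) →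
        (∀ t ∈ Set.Ioo (0:ℝ) T, ∀ x, HasDerivAt (fun τ => u τ x) (ut t x) t) →
        (∀ t ∈ Set.Icc (0:ℝ) T, ContDiff ℝ 2 (u t)) →
        (∀ t ∈ Set.Icc (0:ℝ) T, Integrable (u t)) →
        Integrable g →
        (∀ t ∈ Set.Icc (0:ℝ) T, ∀ x,
          |u t x| + ‖gradient (u t) x‖ + |lap (u t) x| ≤ g x) →
        (∀ t ∈ Set.Ioo (0:ℝ) T, ∀ x,
          ut t x + diverg (fun z => f (u t z) • ∫ y, u t y • K (z - y)) x
            = ε * lap (u t) x) →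
        C * (∫ x, |diverg K x|) * (1 + (⨆ x, |u 0 x|) ^ α) * T ≤ 1 →
        ∀ t ∈ Set.Icc (0:ℝ) T, ∀ x, |u t x| ≤ 2 * ⨆ x, |u 0 x| := by
  refine ⟨4 * C₀ * (1 + 4 ^ α), by positivity, ?_⟩
  intro ε hε f hf _ hfb K hK ⟨MK, hMK⟩ ⟨MJ, hMJ⟩ hdiv T hT u ut g Mu hMu hcont hderiv hC2 hint
    hg hug heq hsmall
  set D := ∫ x, |diverg K x| with hD
  set M₀ := ⨆ x, |u 0 x| with hM₀
  have hD0 : 0 ≤ D := integral_nonneg fun x => abs_nonneg _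
  have hM₀0 : 0 ≤ M₀ := Real.iSup_nonneg fun x => abs_nonneg _
  have h0T : (0 : ℝ) ∈ Set.Icc 0 T := ⟨le_rfl, hT.le⟩
  have hu0 : ∀ x, |u 0 x| ≤ M₀ := fun x =>
    le_ciSup (f := fun x => |u 0 x|) ⟨Mu, by rintro _ ⟨y, rfl⟩; exact hMu 0 h0T y⟩ x
  have main : ∀ δ, 0 < δ → δ ≤ 1 → ∀ t ∈ Set.Icc (0 : ℝ) T, ∀ x, |u t x| ≤ 2 * (M₀ + δ) := by
    intro δ hδ hδ1
    refine le_two_mul_of_linear_growth (rate := fun B => C₀ * (1 + B ^ α) * (B * D))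
      (by positivity) hMu (fun x => by linarith [hu0 x]) ?_ (by positivity) ?_
    · intro a b B S ha hb hB hS
      have hI : Set.Icc a b ⊆ Set.Icc 0 T := Set.Icc_subset_Icc ha hb
      have hI' : Set.Ioo a b ⊆ Set.Ioo 0 T := Set.Ioo_subset_Ioo ha hb
      exact abs_le_add_of_viscous_nonlocal hα hC₀ hε hf hfb hK hMK hMJ hdiv hB
        (hcont.mono (Set.prod_mono hI subset_rfl)) (fun t ht => hderiv t (hI' ht))
        (fun t ht => hC2 t (hI ht)) (fun t ht => hint t (hI ht)) hg
        (fun t ht x => by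
          linarith [hug t (hI ht) x, norm_nonneg (gradient (u t) x), abs_nonneg (lap (u t) x)])
        (fun t ht => heq t (hI' ht)) hS
    · calc C₀ * (1 + (2 * (M₀ + δ)) ^ α) * (2 * (M₀ + δ) * D) * T
          ≤ C₀ * ((1 + 4 ^ α) * (1 + M₀ ^ α)) * (2 * (M₀ + δ) * D) * T := by
            gcongr
            exact two_mul_add_rpow_le hα hM₀0 hδ.le hδ1
        _ = (4 * C₀ * (1 + 4 ^ α) * D * (1 + M₀ ^ α) * T) * ((M₀ + δ) / 2) := by ring
        _ ≤ (M₀ + δ) / 2 := mul_le_of_le_one_left (by positivity) hsmall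
  intro t ht x
  refine le_of_forall_pos_le_add fun η hη => ?_
  have h1 := main (min 1 (η / 2)) (by positivity) (min_le_left _ _) t ht x
  have h2 := min_le_right 1 (η / 2)
  linarith
end
end
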